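/- arXiv:2203.16227 — 2 statements merged into one kernel-verified Lean document; each statement's English description precedes it below -/
import Mathlib

section
/- If the cost function c satisfies Assumptions (A) and (B), then it satisfies Assumption (Approx). -/
open MeasureTheory ProbabilityTheory Topology Filter Set Metric
open scoped NNReal ENNReal

noncomputable section

namespace UWOT

/-- The nonnegative part of an extended real, as an extended nonnegative real. -/
def epos (x : EReal) : ℝ≥0∞ := if x = ⊤ then ⊤ else ENNReal.ofReal x.toReal

/-- Integral of an `EReal`-valued function: positive part minus negative part. -/
def eintegral {α : Type*} [MeasurableSpace α] (μ : Measure α) (g : α → EReal) : EReal :=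
  ((∫⁻ x, epos (g x) ∂μ : ℝ≥0∞) : EReal) - ((∫⁻ x, epos (-(g x)) ∂μ : ℝ≥0∞) : EReal)

/-- Integral of a real-valued function, with value `+∞` when the positive part is not
integrable.  This is the integral "understood in `ℝ ∪ {+∞}`". -/
def eintegralR {α : Type*} [MeasurableSpace α] (μ : Measure α) (f : α → ℝ) : EReal :=
  eintegral μ fun x => (f x : EReal)

variable {X Y : Type*}
  [TopologicalSpace X] [PolishSpace X] [MeasurableSpace X] [BorelSpace X]
  [TopologicalSpace Y] [PolishSpace Y] [MeasurableSpace Y] [BorelSpace Y]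

/-- A nonnegative kernel from `X` to `Y` : a measurable family of finite nonnegative
measures on `Y`. -/
def IsKernel (q : X → FiniteMeasure Y) : Prop :=
  Measurable fun x => (q x : Measure Y)

/-- `μ q = ν` : the kernel `q` transports `μ` onto `ν`. -/
def Transports (μ : Measure X) (q : X → FiniteMeasure Y) (ν : Measure Y) : Prop :=
  μ.bind (fun x => (q x : Measure Y)) = ν

/-- The transport cost `I_c(μ,ν)`, an infimum in `ℝ ∪ {+∞}` (it equals `⊤` when no
admissible kernel exists). -/
def transportCost (c : X → FiniteMeasure Y → ℝ) (μ : Measure X) (ν : Measure Y) : EReal :=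
  sInf {r : EReal | ∃ q : X → FiniteMeasure Y,
    IsKernel q ∧ Transports μ q ν ∧ r = eintegralR μ fun x => c x (q x)}

/-- Standing assumptions on the cost function: convexity in the second variable, joint
lower semicontinuity, and the lower bound (LB). -/
structure IsCost (c : X → FiniteMeasure Y → ℝ) : Prop where
  convex : ∀ (x : X) (m₀ m₁ : FiniteMeasure Y) (t : ℝ≥0), t ≤ 1 →
    c x ((1 - t) • m₀ + t • m₁) ≤ (1 - (t : ℝ)) * c x m₀ + (t : ℝ) * c x m₁
  lsc : LowerSemicontinuous fun p : X × FiniteMeasure Y => c p.1 p.2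
  lb : ∃ r₀ r₁ : ℝ, ∀ (x : X) (m : FiniteMeasure Y), r₀ + r₁ * (m.mass : ℝ) ≤ c x m

/-- The topological support of a measure. -/
def msupport {Z : Type*} [TopologicalSpace Z] [MeasurableSpace Z] (μ : Measure Z) : Set Z :=
  {x | ∀ U : Set Z, IsOpen U → x ∈ U → 0 < μ U}

/-- Membership in `Π(≪ μ, ν)`. -/
def MemPiAC (μ : Measure X) (ν : Measure Y) (π : ProbabilityMeasure (X × Y)) : Prop :=
  (π : Measure (X × Y)).fst ≪ μ ∧ (π : Measure (X × Y)).snd = ν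

/-- Membership in `Π(Supp(μ), ν)`. -/
def MemPiSupp (μ : Measure X) (ν : Measure Y) (π : ProbabilityMeasure (X × Y)) : Prop :=
  (π : Measure (X × Y)).fst (msupport μ) = 1 ∧ (π : Measure (X × Y)).snd = ν

variable [Nonempty Y]

/-- The disintegration kernel `π^x` of `π` with respect to its first marginal, as a
finite (probability) measure. -/
def condFM (π : ProbabilityMeasure (X × Y)) (x : X) : FiniteMeasure Y :=
  ⟨(π : Measure (X × Y)).condKernel x, inferInstance⟩

/-- The measure `(dπ₁/dμ)(x) • π^x`. -/
def fiber (μ : Measure X) (π : ProbabilityMeasure (X × Y)) (x : X) : FiniteMeasure Y :=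
  ((π : Measure (X × Y)).fst.rnDeriv μ x).toNNReal • condFM π x

/-- The functional `I_c^μ[π] = ∫ c(x, (dπ₁/dμ)(x) π^x) dμ`, in `ℝ ∪ {+∞}`. -/
def Icmu (c : X → FiniteMeasure Y → ℝ) (μ : Measure X) (π : ProbabilityMeasure (X × Y)) :
    EReal :=
  eintegralR μ fun x => c x (fiber μ π x)

/-- A strong solution of the transport problem. -/
def IsStrongSol (c : X → FiniteMeasure Y → ℝ) (μ : Measure X) (ν : Measure Y)
    (π : ProbabilityMeasure (X × Y)) : Prop :=
  MemPiAC μ ν π ∧ Icmu c μ π = transportCost c μ ν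

/-- A weak solution of the transport problem. -/
def IsWeakSol (c : X → FiniteMeasure Y → ℝ) (μ : Measure X) (ν : Measure Y)
    (π : ProbabilityMeasure (X × Y)) : Prop :=
  ∃ s : ℕ → ProbabilityMeasure (X × Y), (∀ n, MemPiAC μ ν (s n)) ∧
    Tendsto s atTop (𝓝 π) ∧
    Tendsto (fun n => Icmu c μ (s n)) atTop (𝓝 (transportCost c μ ν))

/-- The recession function `c'_∞(x,m) = lim_{λ→∞} c(x, λm)/λ`. -/
def recession (c : X → FiniteMeasure Y → ℝ) (x : X) (m : FiniteMeasure Y) : EReal :=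
  limsup (fun lam : ℝ≥0 => ((c x (lam • m) / (lam : ℝ) : ℝ) : EReal)) atTop

/-- The extended functional `bar I_c^μ[π]`. -/
def barI (c : X → FiniteMeasure Y → ℝ) (μ : Measure X) (π : ProbabilityMeasure (X × Y)) :
    EReal :=
  eintegralR μ (fun x => c x (fiber μ π x)) +
    eintegral ((π : Measure (X × Y)).fst.singularPart μ) (fun x => recession c x (condFM π x))

/-- Assumption (A). -/
def AssumpA (c : X → FiniteMeasure Y → ℝ) : Prop :=
  ∃ (a : ℕ → C(X, ℝ)) (b : ℕ → C(X × Y, ℝ)),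
    ∀ (x : X) (m : FiniteMeasure Y),
      IsLUB (range fun k => (∫ y, b k (x, y) ∂(m : Measure Y)) + a k x) (c x m)

/-- Assumption (B). -/
def AssumpB (c : X → FiniteMeasure Y → ℝ) : Prop :=
  ∀ (x : X) (m : FiniteMeasure Y), m ≠ 0 →
    Tendsto (fun lam : ℝ≥0 => c x (lam • m) / (lam : ℝ)) atTop atTop

/-- Assumption (C). -/
def AssumpC (c : X → FiniteMeasure Y → ℝ) : Prop :=
  (∀ m : FiniteMeasure Y, Continuous fun x : X => c x m) ∧
  (∀ m : FiniteMeasure Y, Continuous fun x : X => recession c x m) ∧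
  (∃ a : ℝ, 0 ≤ a ∧
    ∀ (x : X) (p : FiniteMeasure Y), p.mass = 1 → recession c x p ≤ (a : EReal))

/-- Assumption (Approx). -/
def AssumpApprox (c : X → FiniteMeasure Y → ℝ) : Prop :=
  ∀ (μ : Measure X) (ν : Measure Y), IsProbabilityMeasure μ → IsProbabilityMeasure ν →
    ∀ π : ProbabilityMeasure (X × Y), MemPiSupp μ ν π →
      ∃ s : ℕ → ProbabilityMeasure (X × Y), (∀ n, MemPiAC μ ν (s n)) ∧
        Tendsto (fun n => Icmu c μ (s n)) atTop (𝓝 (barI c μ π))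

/-- The operator `K_c` acting on continuous functions. -/
def Kc (c : X → FiniteMeasure Y → ℝ) (f : Y → ℝ) (x : X) : EReal :=
  ⨅ m : FiniteMeasure Y, (((∫ y, f y ∂(m : Measure Y)) + c x m : ℝ) : EReal)


set_option linter.unusedSectionVars false

/-- Integrals of continuous functions depending continuously on a parameter are jointly
continuous in the parameter and the probability measure. -/
lemma continuous_integral_prod [CompactSpace Y] (b : C(X × Y, ℝ)) :
    Continuous fun z : X × ProbabilityMeasure Y => ∫ y, b (z.1, y) ∂(z.2 : Measure Y) := by
  have hint (F : C(Y, ℝ)) (p : ProbabilityMeasure Y) : Integrable F (p : Measure Y) :=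
    F.continuous.integrable_of_hasCompactSupport (HasCompactSupport.of_compactSpace F)
  have key : Continuous fun z : C(Y, ℝ) × ProbabilityMeasure Y =>
      ∫ y, z.1 y ∂(z.2 : Measure Y) := by
    refine continuous_prod_of_continuous_lipschitzWith _ 1 (fun F => ?_) (fun p => ?_)
    · exact ProbabilityMeasure.continuous_integral_boundedContinuousFunction
        (BoundedContinuousFunction.mkOfCompact F)
    · refine LipschitzWith.of_dist_le_mul fun F G => ?_
      rw [Real.dist_eq, ← integral_sub (hint F p) (hint G p), ← Real.norm_eq_abs]
      refine (norm_integral_le_of_norm_le_const (C := dist F G)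
        (Eventually.of_forall fun y => ?_)).trans (by simp)
      rw [← dist_eq_norm]
      exact ContinuousMap.dist_apply_le_dist y
  exact key.comp ((b.curry.continuous.comp continuous_fst).prodMk continuous_snd)

/-- Under (A) and (B), some of the linear functionals representing the cost are arbitrarily
large on any probability measure. -/
lemma exists_lt_integral {c : X → FiniteMeasure Y → ℝ} (hB : AssumpB c)
    {a : ℕ → C(X, ℝ)} {b : ℕ → C(X × Y, ℝ)}
    (hab : ∀ (x : X) (m : FiniteMeasure Y),
      IsLUB (range fun k => (∫ y, b k (x, y) ∂(m : Measure Y)) + a k x) (c x m))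
    (M : ℝ) (x : X) (p : ProbabilityMeasure Y) :
    ∃ k, M < ∫ y, b k (x, y) ∂(p : Measure Y) := by
  by_contra! h
  have hp : p.toFiniteMeasure ≠ 0 := fun h0 => by
    have := p.mass_toFiniteMeasure
    simp [h0] at this
  have hle (l : ℝ≥0) : c x (l • p.toFiniteMeasure) ≤ l * M + c x 0 := by
    refine (hab x _).2 ?_
    rintro _ ⟨k, rfl⟩
    have h0 : a k x ≤ c x 0 := by simpa using (hab x 0).1 ⟨k, rfl⟩
    have h1 : ∫ y, b k (x, y) ∂((l • p.toFiniteMeasure : FiniteMeasure Y) : Measure Y)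
        = l * ∫ y, b k (x, y) ∂(p : Measure Y) := by
      rw [FiniteMeasure.toMeasure_smul, integral_smul_nnreal_measure]
      rfl
    have h2 := mul_le_mul_of_nonneg_left (h k) l.coe_nonneg
    simp only [h1]
    linarith
  obtain ⟨l, hl, hl1⟩ := (((hB x _ hp).eventually_gt_atTop (M + |c x 0|)).and
    (eventually_ge_atTop 1)).exists
  have hl1' : (1 : ℝ) ≤ l := by exact_mod_cast hl1
  rw [lt_div_iff₀ (by linarith)] at hl
  nlinarith [hle l, le_abs_self (c x 0), abs_nonneg (c x 0)]

/-- Under (A) and (B), the cost is superlinear uniformly in the point and in the direction. -/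
lemma exists_uniform_superlinear_bound [CompactSpace X] [CompactSpace Y]
    {c : X → FiniteMeasure Y → ℝ} (hA : AssumpA c) (hB : AssumpB c) (M : ℝ) :
    ∃ A : ℝ, 0 ≤ A ∧ ∀ (x : X) (p : ProbabilityMeasure Y) (l : ℝ≥0),
      M * l - A ≤ c x (l • p.toFiniteMeasure) := by
  obtain ⟨a, b, hab⟩ := hA
  obtain ⟨t, ht⟩ := isCompact_univ.elim_finite_subcover
    (fun k => {z : X × ProbabilityMeasure Y | M < ∫ y, b k (z.1, y) ∂(z.2 : Measure Y)})
    (fun k => isOpen_lt continuous_const (continuous_integral_prod (b k)))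
    (fun z _ => mem_iUnion.2 (exists_lt_integral hB hab M z.1 z.2))
  refine ⟨∑ k ∈ t, ‖a k‖, by positivity, fun x p l => ?_⟩
  obtain ⟨k, hk, hM⟩ := mem_iUnion₂.1 (ht (mem_univ (x, p)))
  have h1 : (∫ y, b k (x, y) ∂((l • p.toFiniteMeasure : FiniteMeasure Y) : Measure Y)) + a k x
      ≤ c x (l • p.toFiniteMeasure) := (hab x _).1 ⟨k, rfl⟩
  rw [FiniteMeasure.toMeasure_smul, integral_smul_nnreal_measure] at h1
  have h2 : ‖a k‖ ≤ ∑ k ∈ t, ‖a k‖ :=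
    Finset.single_le_sum (f := fun k => ‖a k‖) (fun _ _ => norm_nonneg _) hk
  have h3 : -‖a k‖ ≤ a k x := (abs_le.1 ((a k).norm_coe_le_norm x)).1
  have h4 : (l : ℝ) * M ≤ l * ∫ y, b k (x, y) ∂(p : Measure Y) :=
    mul_le_mul_of_nonneg_left hM.le l.coe_nonneg
  have h5 : l • (∫ y, b k (x, y) ∂(p : Measure Y)) = l * ∫ y, b k (x, y) ∂(p : Measure Y) := rfl
  change l • (∫ y, b k (x, y) ∂(p : Measure Y)) + a k x ≤ _ at h1
  rw [h5] at h1
  linarith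

lemma epos_coe (r : ℝ) : epos (r : EReal) = ENNReal.ofReal r := by
  simp [epos]

/-- The extended integral dominates the Bochner integral of any integrable minorant. -/
lemma integral_le_eintegralR {α : Type*} [MeasurableSpace α] {μ : Measure α} {f g : α → ℝ}
    (hg : Integrable g μ) (hgf : ∀ x, g x ≤ f x) :
    ((∫ x, g x ∂μ : ℝ) : EReal) ≤ eintegralR μ f := by
  have hneg : Integrable (fun x => -g x) μ := hg.neg
  have hp := hg.lintegral_lt_top
  have hn := hneg.lintegral_lt_top
  rw [integral_eq_lintegral_pos_part_sub_lintegral_neg_part hg, EReal.coe_sub,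
    EReal.coe_ennreal_toReal hp.ne, EReal.coe_ennreal_toReal hn.ne, eintegralR, eintegral]
  simp only [← EReal.coe_neg, epos_coe]
  refine EReal.sub_le_sub ?_ ?_ <;> rw [EReal.coe_ennreal_le_coe_ennreal_iff] <;>
    refine lintegral_mono fun x => ENNReal.ofReal_le_ofReal ?_
  · exact hgf x
  · exact neg_le_neg (hgf x)

/-- The conditional law of `π` at `x`, as a probability measure. -/
def condPM (π : ProbabilityMeasure (X × Y)) (x : X) : ProbabilityMeasure Y :=
  ⟨(π : Measure (X × Y)).condKernel x, inferInstance⟩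

lemma fiber_eq (μ : Measure X) (π : ProbabilityMeasure (X × Y)) (x : X) :
    fiber μ π x = ((π : Measure (X × Y)).fst.rnDeriv μ x).toNNReal •
      (condPM π x).toFiniteMeasure := rfl

lemma lb_fiber {c : X → FiniteMeasure Y → ℝ} {r₀ r₁ : ℝ}
    (hr : ∀ (x : X) (m : FiniteMeasure Y), r₀ + r₁ * (m.mass : ℝ) ≤ c x m)
    (μ : Measure X) (π : ProbabilityMeasure (X × Y)) (x : X) :
    r₀ + r₁ * ((π : Measure (X × Y)).fst.rnDeriv μ x).toReal ≤ c x (fiber μ π x) := by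
  have hm : (fiber μ π x).mass = ((π : Measure (X × Y)).fst.rnDeriv μ x).toNNReal := by
    rw [fiber_eq, FiniteMeasure.mass, FiniteMeasure.smul_apply]
    have := (condPM π x).mass_toFiniteMeasure
    rw [FiniteMeasure.mass] at this
    simp [this]
  have := hr x (fiber μ π x)
  rwa [hm] at this

lemma Icmu_ne_bot {c : X → FiniteMeasure Y → ℝ} (hc : IsCost c) (μ : Measure X)
    [IsFiniteMeasure μ] (π : ProbabilityMeasure (X × Y)) : Icmu c μ π ≠ ⊥ := by
  obtain ⟨r₀, r₁, hr⟩ := hc.lb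
  exact ((EReal.bot_lt_coe _).trans_le (integral_le_eintegralR
    ((integrable_const r₀).add (Measure.integrable_toReal_rnDeriv.const_mul r₁))
    (lb_fiber hr μ π))).ne'

lemma recession_eq_top {c : X → FiniteMeasure Y → ℝ} (hB : AssumpB c) (x : X)
    {m : FiniteMeasure Y} (hm : m ≠ 0) : recession c x m = ⊤ :=
  (EReal.tendsto_coe_nhds_top_iff.2 (hB x m hm)).limsup_eq

lemma barI_of_ac {c : X → FiniteMeasure Y → ℝ} {μ : Measure X} {π : ProbabilityMeasure (X × Y)}
    (h : (π : Measure (X × Y)).fst ≪ μ) : barI c μ π = Icmu c μ π := by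
  simp [barI, Icmu, eintegral, Measure.singularPart_eq_zero_of_ac h]

lemma barI_of_not_ac {c : X → FiniteMeasure Y → ℝ} (hc : IsCost c) (hB : AssumpB c)
    {μ : Measure X} [IsFiniteMeasure μ] {π : ProbabilityMeasure (X × Y)}
    (h : ¬ (π : Measure (X × Y)).fst ≪ μ) : barI c μ π = ⊤ := by
  have hne (x : X) : condFM π x ≠ 0 := fun h0 => by
    have := (condPM π x).mass_toFiniteMeasure
    rw [show (condPM π x).toFiniteMeasure = 0 from h0] at this
    simp at this
  have hs : (π : Measure (X × Y)).fst.singularPart μ univ ≠ 0 := by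
    rwa [ne_eq, Measure.measure_univ_eq_zero, Measure.singularPart_eq_zero]
  have h1 : eintegral ((π : Measure (X × Y)).fst.singularPart μ)
      (fun x => recession c x (condFM π x)) = ⊤ := by
    simp [recession_eq_top hB _ (hne _), eintegral, epos, ENNReal.top_mul hs]
  rw [barI, h1]
  exact EReal.add_top_of_ne_bot (Icmu_ne_bot hc μ π)

/-- If some measure carried by the support of `μ` is not absolutely continuous with respect to
`μ`, then `Icmu` is unbounded above on `Π(≪ μ, ν)`. -/
lemma exists_memPiAC_le_Icmu [CompactSpace X] [CompactSpace Y]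
    {c : X → FiniteMeasure Y → ℝ} (hc : IsCost c) (hA : AssumpA c) (hB : AssumpB c)
    (μ : Measure X) [IsProbabilityMeasure μ] (ν : Measure Y) [IsProbabilityMeasure ν]
    {ρ : Measure X} [IsProbabilityMeasure ρ] (hρ : ρ (msupport μ) = 1) (hac : ¬ ρ ≪ μ) (L : ℝ) :
    ∃ s : ProbabilityMeasure (X × Y), MemPiAC μ ν s ∧ (L : EReal) ≤ Icmu c μ s := by
  classical
  obtain ⟨r₀, r₁, hr⟩ := hc.lb
  obtain ⟨A, hA0, hAc⟩ := exists_uniform_superlinear_bound hA hB (L + 1 + |r₀|)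
  obtain ⟨N, hN, hρN⟩ : ∃ N, μ N = 0 ∧ ρ N ≠ 0 := by
    by_contra! h
    exact hac fun N hN => h N hN
  obtain ⟨U, hNU, hU, hμU⟩ := N.exists_isOpen_lt_of_lt (μ := μ) (ENNReal.ofReal (1 / (A + 1)))
    (by rw [hN]; exact ENNReal.ofReal_pos.2 (by positivity))
  have hUmeas := hU.measurableSet
  have hU0 : μ U ≠ 0 := by
    obtain ⟨x, hxU, hx⟩ : ∃ x ∈ U, x ∈ msupport μ := by
      by_contra! h
      have h1 : ρ Uᶜ = 1 :=
        le_antisymm prob_le_one (hρ ▸ measure_mono fun x hx hxU => h x hxU hx)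
      rw [prob_compl_eq_one_iff hUmeas] at h1
      exact hρN (measure_mono_null hNU h1)
    exact (hx U hU hxU).ne'
  have hAU : A * μ.real U ≤ 1 := by
    have h1 : μ.real U ≤ 1 / (A + 1) :=
      ENNReal.toReal_le_of_le_ofReal (by positivity) hμU.le
    calc A * μ.real U ≤ A * (1 / (A + 1)) := by gcongr
      _ ≤ 1 := by rw [mul_one_div, div_le_one (by positivity)]; linarith
  have := cond_isProbabilityMeasure hU0
  have hcond : μ[|U] ≪ μ := cond_absolutelyContinuous
  let s : ProbabilityMeasure (X × Y) := ⟨(μ[|U]).prod ν, inferInstance⟩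
  have hfst : (s : Measure (X × Y)).fst = μ[|U] := Measure.fst_prod
  refine ⟨s, ⟨hfst ▸ hcond, Measure.snd_prod⟩, ?_⟩
  let f : X → ℝ := fun x => ((μ[|U]).rnDeriv μ x).toReal
  have hf : Integrable f μ := Measure.integrable_toReal_rnDeriv
  have hfU : ∫ x in U, f x ∂μ = 1 := by
    rw [Measure.setIntegral_toReal_rnDeriv hcond, measureReal_def, cond_apply_self hU0 (measure_ne_top _ _),
      ENNReal.toReal_one]
  have hfUc : ∫ x in Uᶜ, f x ∂μ = 0 := by
    rw [Measure.setIntegral_toReal_rnDeriv hcond, measureReal_def, cond_apply hUmeas]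
    simp
  have hg₁ : Integrable (fun x => (L + 1 + |r₀|) * f x - A) μ :=
    (hf.const_mul _).sub (integrable_const _)
  have hg₂ : Integrable (fun x => r₀ + r₁ * f x) μ :=
    (integrable_const _).add (hf.const_mul _)
  have hle := integral_le_eintegralR (μ := μ) (f := fun x => c x (fiber μ s x))
    (Integrable.piecewise hUmeas hg₁.integrableOn hg₂.integrableOn) (fun x => by
      by_cases hx : x ∈ U
      · rw [piecewise_eq_of_mem _ _ _ hx, fiber_eq, hfst]
        exact hAc x _ _
      · rw [piecewise_eq_of_notMem _ _ _ hx]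
        have := lb_fiber hr μ s x
        rwa [hfst] at this)
  refine le_trans (EReal.coe_le_coe_iff.2 ?_) hle
  rw [integral_piecewise hUmeas hg₁.integrableOn hg₂.integrableOn,
    integral_sub (hf.const_mul _).integrableOn (integrable_const _),
    integral_add (integrable_const _) (hf.const_mul _).integrableOn,
    integral_const_mul, integral_const_mul, hfU, hfUc]
  simp only [setIntegral_const, smul_eq_mul]
  have h1 : μ.real Uᶜ * |r₀| ≤ 1 * |r₀| := by
    gcongr
    exact measureReal_le_one
  have h2 : μ.real Uᶜ * -|r₀| ≤ μ.real Uᶜ * r₀ := by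
    gcongr
    exact neg_abs_le r₀
  linarith

/-- Lemma `lem:BAprox`: Assumptions (A) and (B) imply Assumption
(Approx). -/
theorem assumpApprox_of_assumpA_assumpB
    [CompactSpace X] [CompactSpace Y]
    (c : X → FiniteMeasure Y → ℝ) (hc : IsCost c) (hA : AssumpA c) (hB : AssumpB c) :
    AssumpApprox c := by
  intro μ ν hμ hν π hπ
  by_cases hac : (π : Measure (X × Y)).fst ≪ μ
  · exact ⟨fun _ => π, fun _ => ⟨hac, hπ.2⟩, by rw [barI_of_ac hac]; exact tendsto_const_nhds⟩
  · choose s hs hL using fun n : ℕ => exists_memPiAC_le_Icmu hc hA hB μ ν hπ.1 hac n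
    refine ⟨s, hs, ?_⟩
    rw [barI_of_not_ac hc hB hac]
    exact tendsto_nhds_top_mono (EReal.tendsto_coe_nhds_top_iff.2 tendsto_natCast_atTop_atTop)
      (Eventually.of_forall hL)

end UWOT
end
end

section
/- Assume c satisfies Assumptions (A) and (Approx). Then for all μ ∈ P(X) and ν ∈ P(Y): I_c(μ,ν) = sup_{f ∈ C_b(Y)} { ∫ K_c f(x) μ(dx) − ∫ f(y) ν(dy) }, where C_b(Y) is the set of bounded continuous functions on Y and K_c f(x) = inf_{m ∈ M(Y)} { ∫ f dm + c(x,m) } (the integral ∫ K_c f dμ being understood in ℝ ∪ {−∞}). In particular, this duality formula holds whenever c satisfies Assumption (A) together with Assumption (B) or Assumption (C). -/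
open MeasureTheory ProbabilityTheory Topology Filter Set Metric
open scoped NNReal ENNReal

noncomputable section

namespace UWOT

variable {X Y : Type*}
  [TopologicalSpace X] [PolishSpace X] [MeasurableSpace X] [BorelSpace X]
  [TopologicalSpace Y] [PolishSpace Y] [MeasurableSpace Y] [BorelSpace Y]

variable [Nonempty Y]

set_option linter.unusedSectionVars false

section ExtendedIntegral

variable {α : Type*} [MeasurableSpace α]

theorem epos_mono {x y : EReal} (h : x ≤ y) : epos x ≤ epos y :=
  EReal.toENNReal_le_toENNReal h

theorem eintegral_mono_ae {μ : Measure α} {g₁ g₂ : α → EReal} (h : ∀ᵐ x ∂μ, g₁ x ≤ g₂ x) :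
    eintegral μ g₁ ≤ eintegral μ g₂ := by
  refine EReal.sub_le_sub ?_ ?_
  · exact EReal.coe_ennreal_le_coe_ennreal_iff.2
      (lintegral_mono_ae (h.mono fun x hx => epos_mono hx))
  · exact EReal.coe_ennreal_le_coe_ennreal_iff.2
      (lintegral_mono_ae (h.mono fun x hx => epos_mono (EReal.neg_le_neg_iff.2 hx)))

theorem epos_add_real (G : ℝ≥0∞) (s : ℝ) :
    epos ((G : EReal) + (s : EReal)) + ENNReal.ofReal (-s) =
      epos (-((G : EReal) + (s : EReal))) + G + ENNReal.ofReal s := by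
  induction G with
  | top => simp [epos]
  | coe g =>
    have h1 : ((g : ℝ≥0∞) : EReal) + (s : EReal) = (((g : ℝ) + s : ℝ) : EReal) := by
      push_cast; rfl
    have e : ∀ r : ℝ, epos (r : EReal) = ENNReal.ofReal r := fun r => rfl
    rw [h1, ← EReal.coe_neg, e, e]
    have hg : (g : ℝ≥0∞) = ENNReal.ofReal (g : ℝ) := (ENNReal.ofReal_coe_nnreal).symm
    rw [hg]
    have h0 : (0 : ℝ) ≤ g := g.2
    have E : ∀ r : ℝ, ENNReal.ofReal r = ENNReal.ofReal (max r 0) := by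
      intro r; rcases le_total r 0 with h | h
      · simp [h]
      · simp [h]
    rw [E, E (-s), E (-(_)), E s, ← ENNReal.ofReal_add (by positivity) (by positivity),
      ← ENNReal.ofReal_add (by positivity) (by positivity),
      ← ENNReal.ofReal_add (by positivity) (by positivity)]
    congr 1
    rcases max_cases (g + s) 0 with h | h <;> rcases max_cases (-s) 0 with h' | h' <;>
      rcases max_cases (-(g + s)) 0 with h'' | h'' <;> rcases max_cases s 0 with h₃ | h₃ <;>
      linarith

theorem eintegral_add_real {μ : Measure α} {G : α → ℝ≥0∞} {s : α → ℝ} (hG : Measurable G)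
    (hs : Integrable s μ) :
    eintegral μ (fun x => (G x : EReal) + (s x : EReal)) =
      ((∫⁻ x, G x ∂μ : ℝ≥0∞) : EReal) + ((∫ x, s x ∂μ : ℝ) : EReal) := by
  have hsm : AEMeasurable s μ := hs.1.aemeasurable
  have hm : AEMeasurable (fun x => (G x : EReal) + (s x : EReal)) μ :=
    hG.coe_ereal_ennreal.aemeasurable.add hsm.coe_real_ereal
  set P := ∫⁻ x, epos ((G x : EReal) + (s x : EReal)) ∂μ with hP
  set N := ∫⁻ x, epos (-((G x : EReal) + (s x : EReal))) ∂μ with hN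
  set Sp := ∫⁻ x, ENNReal.ofReal (s x) ∂μ with hSp
  set Sn := ∫⁻ x, ENNReal.ofReal (-s x) ∂μ with hSn
  have key : P + Sn = N + (∫⁻ x, G x ∂μ) + Sp := by
    rw [hP, hN, hSp, hSn, ← lintegral_add_right' _ (by fun_prop),
      ← lintegral_add_right' _ (by fun_prop), ← lintegral_add_right' _ (by fun_prop)]
    exact lintegral_congr fun x => epos_add_real _ _
  have hSpf : Sp ≠ ⊤ := hs.lintegral_lt_top.ne
  have hSnf : Sn ≠ ⊤ := hs.neg.lintegral_lt_top.ne
  have hNf : N ≠ ⊤ := by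
    refine ne_top_of_le_ne_top hSnf (lintegral_mono fun x => ?_)
    have : epos ((-s x : ℝ) : EReal) = ENNReal.ofReal (-s x) := rfl
    rw [← this]
    apply epos_mono
    rw [EReal.coe_neg, EReal.neg_le_neg_iff]
    exact le_add_of_nonneg_left (EReal.coe_ennreal_nonneg _)
  have hS : ∫ x, s x ∂μ = Sp.toReal - Sn.toReal :=
    integral_eq_lintegral_pos_part_sub_lintegral_neg_part hs
  have hE : eintegral μ (fun x => (G x : EReal) + (s x : EReal)) = (P : EReal) - N := rfl
  rw [hE, hS]
  generalize (∫⁻ x, G x ∂μ) = I at *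
  clear_value P N Sp Sn
  lift N to ℝ≥0 using hNf
  lift Sp to ℝ≥0 using hSpf
  lift Sn to ℝ≥0 using hSnf
  induction I with
  | top =>
    have : P = ⊤ := by
      by_contra h
      lift P to ℝ≥0 using h
      simp at key
    subst this
    have : ((N : ℝ≥0∞) : EReal) = ((N : ℝ) : EReal) := rfl
    rw [this, EReal.coe_ennreal_top, EReal.top_sub_coe, EReal.top_add_coe]
  | coe i =>
    have hPf : P ≠ ⊤ := by
      rintro rfl
      simp at key
      exact absurd key.symm (by exact_mod_cast ENNReal.coe_ne_top)
    lift P to ℝ≥0 using hPf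
    have key' : (P : ℝ) + Sn = N + i + Sp := by exact_mod_cast key
    have h1 : ∀ r : ℝ≥0, ((r : ℝ≥0∞) : EReal) = ((r : ℝ) : EReal) := fun r => rfl
    rw [h1, h1, h1, ← EReal.coe_sub, ← EReal.coe_add]
    congr 1
    simp only [ENNReal.coe_toReal]
    linarith

theorem integral_le_eintegral {μ : Measure α} {g : α → EReal} {s : α → ℝ} (hs : Integrable s μ)
    (h : ∀ᵐ x ∂μ, (s x : EReal) ≤ g x) : ((∫ x, s x ∂μ : ℝ) : EReal) ≤ eintegral μ g := by
  have := eintegral_add_real (G := fun _ => 0) measurable_const hs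
  simp only [EReal.coe_ennreal_zero, zero_add, lintegral_zero] at this
  rw [← this]
  exact eintegral_mono_ae h

end ExtendedIntegral

section Transport

/-- A nonnegative kernel, as a Mathlib kernel. -/
def kernelOf (q : X → FiniteMeasure Y) (hq : IsKernel q) : Kernel X Y :=
  ⟨fun x => (q x : Measure Y), hq⟩

theorem IsKernel.measurable_mass {q : X → FiniteMeasure Y} (hq : IsKernel q) :
    Measurable fun x => (q x).mass := by
  have : Measurable fun x => (q x : Measure Y) univ :=
    (Measure.measurable_coe MeasurableSet.univ).comp hq
  exact this.ennreal_toNNReal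

instance isSFiniteKernel_kernelOf (q : X → FiniteMeasure Y) (hq : IsKernel q) :
    IsSFiniteKernel (kernelOf q hq) := by
  have hm := hq.measurable_mass
  have hk : Measurable fun x => ((q x).mass)⁻¹ • (q x : Measure Y) := by
    refine Measure.measurable_of_measurable_coe _ fun s hs => ?_
    have h1 : Measurable fun x => (q x : Measure Y) s := (Measure.measurable_coe hs).comp hq
    simp only [Measure.smul_apply, ENNReal.smul_def, smul_eq_mul]
    exact (hm.inv.coe_nnreal_ennreal).mul h1
  let κ : Kernel X Y := ⟨fun x => ((q x).mass)⁻¹ • (q x : Measure Y), hk⟩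
  have : IsFiniteKernel κ := by
    refine ⟨1, ENNReal.one_lt_top, fun x => ?_⟩
    change (((q x).mass)⁻¹ • (q x : Measure Y)) univ ≤ 1
    rw [Measure.smul_apply, ← FiniteMeasure.ennreal_mass, ENNReal.smul_def, smul_eq_mul,
      ← ENNReal.coe_mul]
    exact_mod_cast inv_mul_le_one
  have hf : Measurable (Function.uncurry fun (x : X) (_ : Y) => (((q x).mass : ℝ≥0) : ℝ≥0∞)) :=
    (hm.comp measurable_fst).coe_nnreal_ennreal
  have e : kernelOf q hq = Kernel.withDensity κ fun x _ => ((q x).mass : ℝ≥0) := by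
    ext x : 1
    rw [Kernel.withDensity_apply _ hf, withDensity_const]
    change (q x : Measure Y) = ((q x).mass : ℝ≥0∞) • (((q x).mass)⁻¹ • (q x : Measure Y))
    rcases eq_or_ne ((q x).mass) 0 with h | h
    · rw [FiniteMeasure.mass_zero_iff] at h
      simp [h]
    · change (q x : Measure Y) = ((q x).mass : ℝ≥0) • (((q x).mass)⁻¹ • (q x : Measure Y))
      rw [smul_smul, mul_inv_cancel₀ h, one_smul]
  rw [e]
  infer_instance

theorem measurable_integral_kernel {q : X → FiniteMeasure Y} (hq : IsKernel q)
    {b : X × Y → ℝ} (hb : Measurable b) :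
    Measurable fun x => ∫ y, b (x, y) ∂(q x : Measure Y) :=
  (hb.stronglyMeasurable.integral_kernel_prod_right' (κ := kernelOf q hq)).measurable

theorem Transports.snd_compProd {μ : Measure X} [SFinite μ] {ν : Measure Y}
    {q : X → FiniteMeasure Y} (hq : IsKernel q) (h : Transports μ q ν) :
    (μ ⊗ₘ kernelOf q hq).snd = ν := by
  rw [Measure.snd_compProd]
  exact h

theorem Transports.isProbabilityMeasure_compProd {μ : Measure X} [SFinite μ] {ν : Measure Y}
    [IsProbabilityMeasure ν]
    {q : X → FiniteMeasure Y} (hq : IsKernel q) (h : Transports μ q ν) :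
    IsProbabilityMeasure (μ ⊗ₘ kernelOf q hq) := by
  refine ⟨?_⟩
  rw [← Measure.snd_univ, h.snd_compProd hq, measure_univ]

theorem Transports.integrable_integral {μ : Measure X} [SFinite μ] {ν : Measure Y}
    {q : X → FiniteMeasure Y} (hq : IsKernel q) (h : Transports μ q ν) {f : Y → ℝ}
    (hf : Integrable f ν) :
    Integrable (fun x => ∫ y, f y ∂(q x : Measure Y)) μ ∧
      ∫ x, ∫ y, f y ∂(q x : Measure Y) ∂μ = ∫ y, f y ∂ν := by
  have hs := h.snd_compProd hq
  have hi : Integrable (fun p : X × Y => f p.2) (μ ⊗ₘ kernelOf q hq) := by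
    rw [← hs, Measure.snd] at hf
    exact hf.comp_measurable measurable_snd
  refine ⟨MeasureTheory.Integrable.integral_compProd hi, ?_⟩
  have h2 := Measure.integral_compProd hi
  have h3 : ∫ y, f y ∂ν = ∫ p : X × Y, f p.2 ∂(μ ⊗ₘ kernelOf q hq) := by
    conv_lhs => rw [← hs, Measure.snd]
    rw [integral_map measurable_snd.aemeasurable]
    rw [← Measure.snd, hs]
    exact hf.1
  rw [h3, h2]
  rfl

theorem Transports.integrable_mass {μ : Measure X} [SFinite μ] {ν : Measure Y}
    [IsProbabilityMeasure ν]
    {q : X → FiniteMeasure Y} (hq : IsKernel q) (h : Transports μ q ν) :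
    Integrable (fun x => ((q x).mass : ℝ)) μ ∧ ∫ x, ((q x).mass : ℝ) ∂μ = 1 := by
  have e : ∀ x, ((q x).mass : ℝ) = ∫ _, (1 : ℝ) ∂(q x : Measure Y) := fun x => by
    simp [Measure.real, ← FiniteMeasure.ennreal_mass]
  have := h.integrable_integral hq (integrable_const (1 : ℝ))
  simpa only [e, integral_const, smul_eq_mul, mul_one, probReal_univ] using this

/-- The cost `c` minus `r₀ + r₁ m(Y)` is nonnegative, and it is the supremum of a sequence of
functions that are affine and continuous in the measure. -/
structure IsRep (c : X → FiniteMeasure Y → ℝ) (r₀ r₁ : ℝ) (a : ℕ → C(X, ℝ))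
    (b : ℕ → C(X × Y, ℝ)) : Prop where
  nonneg : ∀ x m, r₀ + r₁ * (m.mass : ℝ) ≤ c x m
  isLUB : ∀ (x : X) (m : FiniteMeasure Y),
    IsLUB (range fun k => (∫ y, b k (x, y) ∂(m : Measure Y)) + a k x)
      (c x m - (r₀ + r₁ * (m.mass : ℝ)))

theorem integrable_continuousMap [CompactSpace X] (μ : Measure X) [IsFiniteMeasure μ]
    (f : C(X, ℝ)) : Integrable f μ :=
  f.continuous.integrable_of_hasCompactSupport (HasCompactSupport.of_compactSpace f)

theorem integrable_section [CompactSpace Y] (b : C(X × Y, ℝ)) (x : X) (m : Measure Y)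
    [IsFiniteMeasure m] : Integrable (fun y => b (x, y)) m :=
  (by fun_prop : Continuous fun y => b (x, y)).integrable_of_hasCompactSupport
    (HasCompactSupport.of_compactSpace _)

theorem exists_isRep [CompactSpace Y] {c : X → FiniteMeasure Y → ℝ} (hc : IsCost c)
    (hA : AssumpA c) : ∃ r₀ r₁ a b, IsRep c r₀ r₁ a b := by
  obtain ⟨r₀, r₁, hr⟩ := hc.lb
  obtain ⟨a, b, hab⟩ := hA
  refine ⟨r₀, r₁, fun k => a k - ContinuousMap.const _ r₀,
    fun k => b k - ContinuousMap.const _ r₁, hr, fun x m => ?_⟩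
  have h := hab x m
  have e : ∀ k, (∫ y, (b k - ContinuousMap.const (X × Y) r₁ : C(X × Y, ℝ)) (x, y) ∂(m : Measure Y)) +
      (a k - ContinuousMap.const X r₀ : C(X, ℝ)) x =
      ((∫ y, b k (x, y) ∂(m : Measure Y)) + a k x) - (r₀ + r₁ * (m.mass : ℝ)) := by
    intro k
    simp only [ContinuousMap.sub_apply, ContinuousMap.const_apply]
    rw [integral_sub (integrable_section _ _ _) (integrable_const _)]
    simp [Measure.real, ← FiniteMeasure.ennreal_mass]
    ring
  simp only [e]
  constructor
  · rintro _ ⟨k, rfl⟩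
    exact sub_le_sub_right (h.1 ⟨k, rfl⟩) _
  · intro u hu
    have : c x m ≤ u + (r₀ + r₁ * (m.mass : ℝ)) := by
      refine h.2 ?_
      rintro _ ⟨k, rfl⟩
      have := hu ⟨k, rfl⟩
      simp only at this ⊢
      linarith
    linarith

/-- The nonnegative quantity `c(x,m) - r₀ - r₁ m(Y)`. -/
def excess (c : X → FiniteMeasure Y → ℝ) (r₀ r₁ : ℝ) (x : X) (m : FiniteMeasure Y) : ℝ≥0∞ :=
  ENNReal.ofReal (c x m - (r₀ + r₁ * (m.mass : ℝ)))

theorem IsRep.coe_eq {c : X → FiniteMeasure Y → ℝ} {r₀ r₁ a b} (hr : IsRep c r₀ r₁ a b)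
    (x : X) (m : FiniteMeasure Y) :
    (c x m : EReal) = (excess c r₀ r₁ x m : EReal) + ((r₀ + r₁ * (m.mass : ℝ) : ℝ) : EReal) := by
  rw [excess, EReal.coe_ennreal_ofReal, max_eq_left (sub_nonneg.2 (hr.nonneg x m)),
    ← EReal.coe_add]
  simp

theorem IsRep.measurable_excess {c : X → FiniteMeasure Y → ℝ} {r₀ r₁ a b}
    (hr : IsRep c r₀ r₁ a b) {q : X → FiniteMeasure Y} (hq : IsKernel q) [CompactSpace X]
    [CompactSpace Y] :
    Measurable fun x => excess c r₀ r₁ x (q x) := by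
  refine Measurable.ennreal_ofReal (Measurable.isLUB (fun k => ?_) fun x => hr.isLUB x (q x))
  exact (measurable_integral_kernel hq (b k).continuous.measurable).add
    (a k).continuous.measurable

theorem IsRep.eintegral_add [CompactSpace X] [CompactSpace Y] {c : X → FiniteMeasure Y → ℝ}
    {r₀ r₁ a b}
    (hr : IsRep c r₀ r₁ a b) {q : X → FiniteMeasure Y} (hq : IsKernel q) {μ : Measure X}
    [IsFiniteMeasure μ] (hm : Integrable (fun x => ((q x).mass : ℝ)) μ)
    {s : X → ℝ} (hs : Integrable s μ) :
    eintegral μ (fun x => ((s x + c x (q x) : ℝ) : EReal)) =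
      ((∫⁻ x, excess c r₀ r₁ x (q x) ∂μ : ℝ≥0∞) : EReal) +
      ((∫ x, s x ∂μ + (r₀ * μ.real univ + r₁ * ∫ x, ((q x).mass : ℝ) ∂μ) : ℝ) : EReal) := by
  have e : ∀ x, ((s x + c x (q x) : ℝ) : EReal) = (excess c r₀ r₁ x (q x) : EReal) +
      ((s x + (r₀ + r₁ * ((q x).mass : ℝ)) : ℝ) : EReal) := by
    intro x
    rw [EReal.coe_add, hr.coe_eq, EReal.coe_add (s x)]
    exact add_left_comm _ _ _
  have hi : Integrable (fun x => r₀ + r₁ * ((q x).mass : ℝ)) μ :=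
    (integrable_const _).add (hm.const_mul _)
  simp only [e]
  rw [eintegral_add_real (hr.measurable_excess hq)
      (by exact hs.add hi : Integrable (fun x => s x + (r₀ + r₁ * ((q x).mass : ℝ))) μ),
    integral_add hs hi,
    integral_add (integrable_const _) (hm.const_mul _), integral_const_mul, integral_const,
    smul_eq_mul, mul_comm r₀]

theorem IsRep.eintegralR_eq [CompactSpace X] [CompactSpace Y] {c : X → FiniteMeasure Y → ℝ}
    {r₀ r₁ a b}
    (hr : IsRep c r₀ r₁ a b) {q : X → FiniteMeasure Y} (hq : IsKernel q) {μ : Measure X}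
    [IsFiniteMeasure μ] (hm : Integrable (fun x => ((q x).mass : ℝ)) μ) :
    eintegralR μ (fun x => c x (q x)) =
      ((∫⁻ x, excess c r₀ r₁ x (q x) ∂μ : ℝ≥0∞) : EReal) +
      ((r₀ * μ.real univ + r₁ * ∫ x, ((q x).mass : ℝ) ∂μ : ℝ) : EReal) := by
  have := hr.eintegral_add hq hm (integrable_zero X ℝ μ)
  simpa [eintegralR] using this

theorem IsRep.dual_le [CompactSpace X] [CompactSpace Y] {c : X → FiniteMeasure Y → ℝ}
    {r₀ r₁ a b} (hr : IsRep c r₀ r₁ a b) (μ : Measure X) (ν : Measure Y)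
    [IsProbabilityMeasure μ] [IsProbabilityMeasure ν] (f : C(Y, ℝ)) :
    eintegral μ (fun x => Kc c f x) - ((∫ y, f y ∂ν : ℝ) : EReal) ≤ transportCost c μ ν := by
  refine le_sInf ?_
  rintro _ ⟨q, hq, hT, rfl⟩
  have hm := hT.integrable_mass hq
  have hf := hT.integrable_integral hq (integrable_continuousMap ν f)
  have h1 : eintegral μ (fun x => Kc c f x) ≤
      eintegral μ fun x => (((∫ y, f y ∂(q x : Measure Y)) + c x (q x) : ℝ) : EReal) :=
    eintegral_mono_ae (ae_of_all _ fun x => iInf_le _ (q x))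
  rw [hr.eintegral_add hq hm.1 hf.1, hf.2] at h1
  rw [hr.eintegralR_eq hq hm.1]
  refine (EReal.sub_le_sub h1 le_rfl).trans_eq ?_
  rw [sub_eq_add_neg, ← EReal.coe_neg, add_assoc, ← EReal.coe_add]
  congr 2
  ring

end Transport

section Minimax

theorem exists_mem_forall_lt_of_convex {ι : Type*} [Fintype ι] {W : Set (ι → ℝ)}
    (hW : Convex ℝ W) (hne : W.Nonempty) (t : ℝ)
    (h : ∀ w : ι → ℝ, (∀ i, 0 ≤ w i) → ∑ i, w i = 1 → ∃ v ∈ W, ∑ i, w i * v i < t) :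
    ∃ v ∈ W, ∀ i, v i < t := by
  classical
  by_contra! hcon
  have hO : IsOpen (Set.pi univ fun _ : ι => Iio t) :=
    isOpen_set_pi finite_univ fun _ _ => isOpen_Iio
  have hOc : Convex ℝ (Set.pi univ fun _ : ι => Iio t) := convex_pi fun _ _ => convex_Iio t
  have hdisj : Disjoint (Set.pi univ fun _ : ι => Iio t) W := by
    rw [Set.disjoint_left]
    intro v hv hvW
    obtain ⟨i, hi⟩ := hcon v hvW
    exact absurd (hv i trivial) (not_lt.2 hi)
  obtain ⟨f, u, hf, hu⟩ := geometric_hahn_banach_open hOc hO hW hdisj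
  set w : ι → ℝ := fun i => f (Pi.single i 1) with hw
  have hfs : ∀ v, f v = ∑ i, w i * v i := by
    intro v
    have := LinearMap.pi_apply_eq_sum_univ (f : (ι → ℝ) →ₗ[ℝ] ℝ) v
    simp only [ContinuousLinearMap.coe_coe, smul_eq_mul] at this
    rw [this]
    refine Finset.sum_congr rfl fun i _ => ?_
    rw [mul_comm, hw]
    congr 2
    ext j
    simp [Pi.single_apply, eq_comm]
  have hconst : ∀ r < t, r * ∑ i, w i < u := by
    intro r hr
    have := hf (fun _ => r) fun i _ => hr
    rwa [hfs, ← Finset.sum_mul, mul_comm] at this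
  have hw0 : ∀ i, 0 ≤ w i := by
    intro i
    by_contra! hi
    set r := t - 1
    have hs : ∀ s : ℝ, 0 ≤ s → r * ∑ i, w i - s * w i < u := by
      intro s hs
      have := hf ((fun _ => r) - s • Pi.single i 1) fun j _ => by
        have : 0 ≤ (Pi.single i (1 : ℝ) : ι → ℝ) j := by
          rw [Pi.single_apply]; split_ifs <;> norm_num
        have := mul_nonneg hs this
        simp only [Pi.sub_apply, Pi.smul_apply, smul_eq_mul, mem_Iio]
        linarith [show r < t from by simp [r]]
      rw [map_sub, map_smul, hfs (fun _ => r), ← Finset.sum_mul, mul_comm, smul_eq_mul] at this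
      exact this
    have h1 := hs ((|u - r * ∑ i, w i|) / (-w i)) (by have : 0 < -w i := by linarith
                                                      positivity)
    have h2 : (|u - r * ∑ i, w i|) / (-w i) * w i = -|u - r * ∑ i, w i| := by
      rw [div_neg, neg_mul, div_mul_cancel₀ _ hi.ne]
    rw [h2] at h1
    linarith [le_abs_self (u - r * ∑ i, w i)]
  have htu : t * ∑ i, w i ≤ u := by
    have hlim : Tendsto (fun r : ℝ => r * ∑ i, w i) (𝓝[<] t) (𝓝 (t * ∑ i, w i)) :=
      ((continuous_id.mul continuous_const).tendsto t).mono_left nhdsWithin_le_nhds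
    exact le_of_tendsto hlim (eventually_nhdsWithin_of_forall fun r hr => (hconst r hr).le)
  have hpos : 0 < ∑ i, w i := by
    refine lt_of_le_of_ne (Finset.sum_nonneg fun i _ => hw0 i) fun h0 => ?_
    have hz : ∀ i, w i = 0 := fun i =>
      (Finset.sum_eq_zero_iff_of_nonneg fun i _ => hw0 i).1 h0.symm i (Finset.mem_univ i)
    obtain ⟨v, hv⟩ := hne
    have h1 := hu v hv
    have h2 := hconst (t - 1) (by linarith)
    rw [hfs] at h1
    simp only [hz, zero_mul, Finset.sum_const_zero, mul_zero] at h1 h2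
    linarith
  obtain ⟨v, hv, hlt⟩ := h (fun i => w i / ∑ j, w j) (fun i => div_nonneg (hw0 i) hpos.le)
    (by rw [← Finset.sum_div, div_self hpos.ne'])
  have h1 := hu v hv
  rw [hfs] at h1
  have h2 : ∑ i, w i / (∑ j, w j) * v i = (∑ i, w i * v i) / ∑ j, w j := by
    rw [Finset.sum_div]
    exact Finset.sum_congr rfl fun i _ => by ring
  rw [h2, div_lt_iff₀ hpos] at hlt
  linarith

/-- The pairing of `(B, A)` with a measure `π` on the product and the fixed measure `μ`. -/
def pairing (μ : Measure X) (π : Measure (X × Y)) (p : C(X × Y, ℝ) × C(X, ℝ)) : ℝ :=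
  ∫ z, p.1 z ∂π + ∫ x, p.2 x ∂μ

/-- Probability measures on `X × Y` whose second marginal is `ν` and whose first marginal is
carried by `K`. -/
structure IsPlan (K : Set X) (ν : Measure Y) (π : Measure (X × Y)) : Prop where
  prob : IsProbabilityMeasure π
  snd_eq : π.snd = ν
  carried : ∀ᵐ z ∂π, z.1 ∈ K

variable [CompactSpace X] [CompactSpace Y]

theorem pairing_sum (μ : Measure X) [IsFiniteMeasure μ] (π : Measure (X × Y)) [IsFiniteMeasure π]
    {ι : Type*} (s : Finset ι) (w : ι → ℝ) (p : ι → C(X × Y, ℝ) × C(X, ℝ)) :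
    pairing μ π (∑ i ∈ s, w i • p i) = ∑ i ∈ s, w i * pairing μ π (p i) := by
  simp only [pairing, Prod.fst_sum, Prod.snd_sum, ContinuousMap.coe_sum, Finset.sum_apply,
    Prod.smul_fst, Prod.smul_snd, ContinuousMap.coe_smul, Pi.smul_apply, smul_eq_mul]
  rw [integral_finsetSum _ fun i _ => (integrable_continuousMap π _).const_mul _,
    integral_finsetSum _ fun i _ => (integrable_continuousMap μ _).const_mul _,
    ← Finset.sum_add_distrib]
  exact Finset.sum_congr rfl fun i _ => by rw [integral_const_mul, integral_const_mul]; ring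

theorem isCompact_isPlan {K : Set X} (hK : IsClosed K) (hKne : K.Nonempty) (ν : Measure Y)
    [IsProbabilityMeasure ν] :
    IsCompact {π : ProbabilityMeasure (X × Y) | IsPlan K ν (π : Measure (X × Y))} := by
  let := TopologicalSpace.upgradeIsCompletelyMetrizable X
  refine IsClosed.isCompact ?_
  have hg : Continuous fun z : X × Y => infDist z.1 K :=
    (continuous_infDist_pt K).comp continuous_fst
  have e : {π : ProbabilityMeasure (X × Y) | IsPlan K ν (π : Measure (X × Y))} =
      {π : ProbabilityMeasure (X × Y) |
        π.map (f := Prod.snd) measurable_snd.aemeasurable = ⟨ν, inferInstance⟩} ∩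
      {π : ProbabilityMeasure (X × Y) | ∫ z, infDist z.1 K ∂(π : Measure (X × Y)) = 0} := by
    ext π
    have h1 : ∫ z, infDist z.1 K ∂(π : Measure (X × Y)) = 0 ↔
        ∀ᵐ z ∂(π : Measure (X × Y)), z.1 ∈ K := by
      rw [integral_eq_zero_iff_of_nonneg (fun z => infDist_nonneg)
        (integrable_continuousMap _ ⟨_, hg⟩)]
      refine eventually_congr (ae_of_all _ fun z => ?_)
      rw [hK.mem_iff_infDist_zero hKne]
      rfl
    simp only [mem_inter_iff, Set.mem_ofPred_eq, h1]
    constructor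
    · intro h
      exact ⟨Subtype.ext h.snd_eq, h.carried⟩
    · intro h
      exact ⟨inferInstance, congrArg Subtype.val h.1, h.2⟩
  rw [e]
  refine IsClosed.inter ?_ ?_
  · exact isClosed_eq (ProbabilityMeasure.continuous_map continuous_snd) continuous_const
  · exact isClosed_eq (ProbabilityMeasure.continuous_integral_boundedContinuousFunction
      (BoundedContinuousFunction.mkOfCompact ⟨_, hg⟩)) continuous_const

theorem exists_isPlan_pairing_le {K : Set X} (hK : IsClosed K) (hKne : K.Nonempty)
    (μ : Measure X) [IsFiniteMeasure μ] (ν : Measure Y)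
    [IsProbabilityMeasure ν] {S : Set (C(X × Y, ℝ) × C(X, ℝ))} (hS : Convex ℝ S)
    (hSne : S.Nonempty) (t : ℝ)
    (h : ∀ p ∈ S, ∃ π, IsPlan K ν π ∧ pairing μ π p < t) :
    ∃ π, IsPlan K ν π ∧ ∀ p ∈ S, pairing μ π p ≤ t := by
  classical
  have hcl : ∀ p : S, IsClosed {π : ProbabilityMeasure (X × Y) |
      pairing μ (π : Measure (X × Y)) p.1 ≤ t} := fun p =>
    isClosed_le ((ProbabilityMeasure.continuous_integral_boundedContinuousFunction
      (BoundedContinuousFunction.mkOfCompact p.1.1)).add continuous_const) continuous_const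
  have := IsCompact.inter_iInter_nonempty (isCompact_isPlan hK hKne ν) _ hcl fun u => by
    let W : Set (u → ℝ) := {v | ∃ π, IsPlan K ν π ∧ ∀ i, v i = pairing μ π i.1.1}
    have hWc : Convex ℝ W := by
      rintro v ⟨π, hπ, hv⟩ v' ⟨π', hπ', hv'⟩ α β hα hβ hαβ
      have := hπ.prob
      have := hπ'.prob
      have hsum : ENNReal.ofReal α + ENNReal.ofReal β = 1 := by
        rw [← ENNReal.ofReal_add hα hβ, hαβ, ENNReal.ofReal_one]
      refine ⟨ENNReal.ofReal α • π + ENNReal.ofReal β • π', ⟨⟨?_⟩, ?_, ?_⟩, fun i => ?_⟩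
      · simp [hsum]
      · rw [Measure.snd, Measure.map_add _ _ measurable_snd, Measure.map_smul, Measure.map_smul,
          ← Measure.snd, ← Measure.snd, hπ.snd_eq, hπ'.snd_eq, ← add_smul, hsum, one_smul]
      · rw [ae_add_measure_iff]
        exact ⟨Measure.ae_smul_measure hπ.carried _, Measure.ae_smul_measure hπ'.carried _⟩
      · simp only [Pi.add_apply, Pi.smul_apply, smul_eq_mul, hv, hv', pairing]
        rw [integral_add_measure, integral_smul_measure, integral_smul_measure,
          ENNReal.toReal_ofReal hα, ENNReal.toReal_ofReal hβ]
        · have : β = 1 - α := by linarith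
          subst this
          simp only [smul_eq_mul]
          ring
        · exact (integrable_continuousMap π _).smul_measure ENNReal.ofReal_ne_top
        · exact (integrable_continuousMap π' _).smul_measure ENNReal.ofReal_ne_top
    have hWne : W.Nonempty := by
      obtain ⟨p, hp⟩ := hSne
      obtain ⟨π, hπ, -⟩ := h p hp
      exact ⟨_, π, hπ, fun i => rfl⟩
    obtain ⟨v, ⟨π, hπ, hv⟩, hlt⟩ := exists_mem_forall_lt_of_convex hWc hWne t fun w hw0 hw1 => by
      have hmem : ∑ i, w i • (i : S).1 ∈ S :=
        hS.sum_mem (fun i _ => hw0 i) hw1 fun i _ => i.1.2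
      obtain ⟨π, hπ, hlt⟩ := h _ hmem
      have := hπ.prob
      refine ⟨_, ⟨π, hπ, fun i => rfl⟩, ?_⟩
      rwa [pairing_sum] at hlt
    refine ⟨⟨π, hπ.prob⟩, hπ, ?_⟩
    refine mem_iInter₂.2 fun i hi => ?_
    have := hlt ⟨i, hi⟩
    rw [hv] at this
    exact this.le
  obtain ⟨π, hπ, hle⟩ := this
  simp only [mem_iInter] at hle
  exact ⟨π, hπ, fun p hp => hle ⟨p, hp⟩⟩

end Minimax

section Dual

theorem msupport_eq_support (μ : Measure X) : msupport μ = μ.support := by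
  rw [Measure.support_eq_forall_isOpen]
  ext x
  exact ⟨fun h U hx hU => h U hU hx, fun h U hU hx => h U hx hU⟩

theorem isClosed_msupport (μ : Measure X) : IsClosed (msupport μ) := by
  rw [msupport_eq_support]
  exact Measure.isClosed_support

theorem ae_mem_msupport (μ : Measure X) : ∀ᵐ x ∂μ, x ∈ msupport μ := by
  rw [msupport_eq_support]
  exact Measure.support_mem_ae

theorem msupport_nonempty (μ : Measure X) [IsProbabilityMeasure μ] : (msupport μ).Nonempty := by
  obtain ⟨x, hx⟩ := (ae_mem_msupport μ).exists
  exact ⟨x, hx⟩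

variable [CompactSpace X] [CompactSpace Y]

theorem exists_measurable_near_min {K : Set X} (hK : IsClosed K) (hKne : K.Nonempty)
    (B : C(X × Y, ℝ)) {ε : ℝ} (hε : 0 < ε) :
    ∃ g : Y → X, Measurable g ∧ (∀ y, g y ∈ K) ∧
      ∀ y, B (g y, y) < sInf ((fun x => B (x, y)) '' K) + ε := by
  classical
  have : Nonempty K := hKne.to_subtype
  have hex : ∀ y, ∃ n, B ((TopologicalSpace.denseSeq K n : X), y) <
      sInf ((fun x => B (x, y)) '' K) + ε := by
    intro y
    obtain ⟨_, ⟨x, hx, rfl⟩, hlt⟩ := exists_lt_of_csInf_lt (hKne.image fun x => B (x, y))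
      (lt_add_of_pos_right _ hε)
    have hopen : IsOpen {z : K | B ((z : X), y) < sInf ((fun x => B (x, y)) '' K) + ε} :=
      isOpen_lt (by fun_prop) continuous_const
    obtain ⟨n, hn⟩ := (TopologicalSpace.denseRange_denseSeq K).exists_mem_open hopen
      ⟨⟨x, hx⟩, hlt⟩
    exact ⟨n, hn⟩
  have hcont : Continuous fun y => sInf ((fun x => B (x, y)) '' K) :=
    hK.isCompact.continuous_sInf (f := fun y x => B (x, y)) (by fun_prop)
  have hN : Measurable fun y => Nat.find (hex y) :=
    measurable_find hex fun n => measurableSet_lt (by fun_prop) (hcont.measurable.add_const ε)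
  refine ⟨fun y => (TopologicalSpace.denseSeq K (Nat.find (hex y)) : X), ?_, fun y => Subtype.coe_prop _,
    fun y => Nat.find_spec (hex y)⟩
  exact (measurable_from_nat (f := fun n => (TopologicalSpace.denseSeq K n : X))).comp hN

/-- Continuous affine minorants of the shifted cost. -/
def minorants (c : X → FiniteMeasure Y → ℝ) (r₀ r₁ : ℝ) : Set (C(X × Y, ℝ) × C(X, ℝ)) :=
  {p | ∀ (x : X) (m : FiniteMeasure Y), (∫ y, p.1 (x, y) ∂(m : Measure Y)) + p.2 x ≤
    c x m - (r₀ + r₁ * (m.mass : ℝ))}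

theorem convex_minorants (c : X → FiniteMeasure Y → ℝ) (r₀ r₁ : ℝ) :
    Convex ℝ (minorants c r₀ r₁) := by
  intro p hp q hq α β hα hβ hαβ x m
  have h1 := mul_le_mul_of_nonneg_left (hp x m) hα
  have h2 := mul_le_mul_of_nonneg_left (hq x m) hβ
  have e : ∫ y, (α • p + β • q).1 (x, y) ∂(m : Measure Y) =
      α * ∫ y, p.1 (x, y) ∂(m : Measure Y) + β * ∫ y, q.1 (x, y) ∂(m : Measure Y) := by
    simp only [Prod.fst_add, Prod.smul_fst, ContinuousMap.add_apply, ContinuousMap.smul_apply,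
      smul_eq_mul]
    rw [integral_add ((integrable_section _ _ _).const_mul _)
      ((integrable_section _ _ _).const_mul _), integral_const_mul, integral_const_mul]
  rw [e]
  simp only [Prod.snd_add, Prod.smul_snd, ContinuousMap.add_apply, ContinuousMap.smul_apply,
      smul_eq_mul]
  have : β = 1 - α := by linarith
  subst this
  nlinarith

theorem exists_isPlan_pairing_lt {c : X → FiniteMeasure Y → ℝ} {r₀ r₁ : ℝ} (μ : Measure X)
    (ν : Measure Y) [IsProbabilityMeasure μ] [IsProbabilityMeasure ν] {t : ℝ}
    (ht : ⨆ f : C(Y, ℝ), (eintegral μ (fun x => Kc c f x) - ((∫ y, f y ∂ν : ℝ) : EReal)) <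
      (t : EReal))
    {p : C(X × Y, ℝ) × C(X, ℝ)} (hp : p ∈ minorants c r₀ r₁) :
    ∃ π, IsPlan (msupport μ) ν π ∧ pairing μ π p < t - r₀ - r₁ := by
  set K := msupport μ
  have hK : IsClosed K := isClosed_msupport μ
  have hKne : K.Nonempty := msupport_nonempty μ
  set v : Y → ℝ := fun y => sInf ((fun x => p.1 (x, y)) '' K) with hv
  have hvc : Continuous v :=
    hK.isCompact.continuous_sInf (f := fun y x => p.1 (x, y)) (by fun_prop)
  have hvle : ∀ x ∈ K, ∀ y, v y ≤ p.1 (x, y) := fun x hx y =>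
    csInf_le (hK.isCompact.image (by fun_prop : Continuous fun x => p.1 (x, y))).bddBelow
      ⟨x, hx, rfl⟩
  have hvi : ∀ (m : Measure Y) [IsFiniteMeasure m], Integrable v m := fun m _ =>
    integrable_continuousMap m ⟨v, hvc⟩
  let f : C(Y, ℝ) := ⟨fun y => -(v y + r₁), by fun_prop⟩
  have hKc : ∀ᵐ x ∂μ, ((p.2 x + r₀ : ℝ) : EReal) ≤ Kc c f x := by
    filter_upwards [ae_mem_msupport μ] with x hx
    refine le_iInf fun m => EReal.coe_le_coe_iff.2 ?_
    have h1 := hp x m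
    have h2 : ∫ y, v y ∂(m : Measure Y) ≤ ∫ y, p.1 (x, y) ∂(m : Measure Y) :=
      integral_mono (hvi _) (integrable_section _ _ _) (hvle x hx)
    have h3 : ∫ y, f y ∂(m : Measure Y) = -(∫ y, v y ∂(m : Measure Y) + r₁ * (m.mass : ℝ)) := by
      change ∫ y, -(v y + r₁) ∂(m : Measure Y) = _
      rw [integral_neg, integral_add (hvi _) (integrable_const _)]
      simp [Measure.real, ← FiniteMeasure.ennreal_mass, mul_comm]
    rw [h3]
    linarith
  have hpi : Integrable p.2 μ := integrable_continuousMap μ p.2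
  have hlow := integral_le_eintegral (s := fun x => p.2 x + r₀)
    (hpi.add (integrable_const r₀)) hKc
  have hlt := (le_iSup (fun f : C(Y, ℝ) => eintegral μ (fun x => Kc c f x) -
    ((∫ y, f y ∂ν : ℝ) : EReal)) f).trans_lt ht
  have hlt2 := (EReal.sub_le_sub hlow (le_refl ((∫ y, f y ∂ν : ℝ) : EReal))).trans_lt hlt
  rw [← EReal.coe_sub, EReal.coe_lt_coe_iff] at hlt2
  have h3 : ∫ y, f y ∂ν = -(∫ y, v y ∂ν + r₁) := by
    change ∫ y, -(v y + r₁) ∂ν = _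
    rw [integral_neg, integral_add (hvi _) (integrable_const _)]
    simp
  have h4 : ∫ x, (p.2 x + r₀) ∂μ = ∫ x, p.2 x ∂μ + r₀ := by
    rw [integral_add hpi (integrable_const _)]
    simp
  rw [h3, h4] at hlt2
  set δ := t - (∫ x, p.2 x ∂μ + r₀ - -(∫ y, v y ∂ν + r₁)) with hδ
  have hδ0 : 0 < δ / 2 := by linarith
  obtain ⟨g, hg, hgK, hgv⟩ := exists_measurable_near_min hK hKne p.1 hδ0
  have hgm : Measurable fun y => (g y, y) := hg.prodMk measurable_id
  refine ⟨ν.map fun y => (g y, y), ⟨Measure.isProbabilityMeasure_map hgm.aemeasurable, ?_, ?_⟩, ?_⟩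
  · rw [Measure.snd, Measure.map_map measurable_snd hgm]
    exact Measure.map_id
  · rw [ae_map_iff hgm.aemeasurable (measurable_fst hK.measurableSet)]
    exact ae_of_all _ hgK
  · have hint : ∫ z, p.1 z ∂(ν.map fun y => (g y, y)) ≤ ∫ y, v y ∂ν + δ / 2 := by
      rw [integral_map hgm.aemeasurable (p.1.continuous.measurable.aestronglyMeasurable)]
      have hgi : Integrable (fun y => p.1 (g y, y)) ν :=
        (integrable_map_measure (p.1.continuous.measurable.aestronglyMeasurable)
          hgm.aemeasurable).1 (integrable_continuousMap _ p.1)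
      calc ∫ y, p.1 (g y, y) ∂ν ≤ ∫ y, (v y + δ / 2) ∂ν :=
            integral_mono hgi ((hvi ν).add (integrable_const _)) fun y => (hgv y).le
        _ = _ := by rw [integral_add (hvi ν) (integrable_const _)]; simp
    rw [pairing]
    linarith

end Dual

section Selection

theorem exists_seq_continuous_tendsto_indicator (ρ : Measure X) [IsFiniteMeasure ρ] {E : Set X}
    (hE : MeasurableSet E) :
    ∃ g : ℕ → C(X, ℝ), (∀ n x, 0 ≤ g n x ∧ g n x ≤ 1) ∧
      ∀ᵐ x ∂ρ, Tendsto (fun n => g n x) atTop (𝓝 (E.indicator (fun _ => (1 : ℝ)) x)) := by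
  let := TopologicalSpace.upgradeIsCompletelyMetrizable X
  have hf : MemLp (E.indicator fun _ => (1 : ℝ)) 1 ρ := (memLp_const 1).indicator hE
  have hex : ∀ n : ℕ, ∃ g : BoundedContinuousFunction X ℝ,
      eLpNorm ((E.indicator fun _ => (1 : ℝ)) - (g : X → ℝ)) 1 ρ ≤ ((n : ℝ≥0∞) + 1)⁻¹ ∧
        MemLp g 1 ρ := fun n => hf.exists_boundedContinuous_eLpNorm_sub_le (by simp) (by simp)
  choose g hg hgm using hex
  have hlim : Tendsto (fun n => eLpNorm ((g n : X → ℝ) - E.indicator fun _ => (1 : ℝ)) 1 ρ)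
      atTop (𝓝 0) := by
    refine tendsto_of_tendsto_of_tendsto_of_le_of_le tendsto_const_nhds
      ?_ (fun n => zero_le) (fun n => ?_) (h := fun n : ℕ => ((n : ℝ≥0∞) + 1)⁻¹)
    · have := (tendsto_add_atTop_iff_nat 1).2 ENNReal.tendsto_inv_nat_nhds_zero
      simpa using this
    · rw [eLpNorm_sub_comm]
      exact hg n
  obtain ⟨ns, -, hns⟩ := (tendstoInMeasure_of_tendsto_eLpNorm one_ne_zero
    (fun n => (hgm n).1) hf.1 hlim).exists_seq_tendsto_ae
  refine ⟨fun n => ⟨fun x => max 0 (min 1 (g (ns n) x)), by fun_prop⟩, fun n x =>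
    ⟨le_max_left _ _, max_le zero_le_one (min_le_left _ _)⟩, ?_⟩
  filter_upwards [hns] with x hx
  have h2 := (tendsto_const_nhds (x := (0 : ℝ))).max ((tendsto_const_nhds (x := (1 : ℝ))).min hx)
  have e : max 0 (min 1 (E.indicator (fun _ => (1 : ℝ)) x)) = E.indicator (fun _ => (1 : ℝ)) x := by
    by_cases h : x ∈ E <;> simp [h]
  rw [e] at h2
  exact h2

variable [CompactSpace X] [CompactSpace Y]

/-- Convex combination with coefficients depending continuously on the point of `X`. -/
def mix (g : C(X, ℝ)) (p q : C(X × Y, ℝ) × C(X, ℝ)) : C(X × Y, ℝ) × C(X, ℝ) :=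
  (⟨fun z => g z.1 * p.1 z + (1 - g z.1) * q.1 z, by fun_prop⟩,
    ⟨fun x => g x * p.2 x + (1 - g x) * q.2 x, by fun_prop⟩)

theorem mix_mem_minorants {c : X → FiniteMeasure Y → ℝ} {r₀ r₁ : ℝ} {g : C(X, ℝ)}
    (hg : ∀ x, 0 ≤ g x ∧ g x ≤ 1) {p q : C(X × Y, ℝ) × C(X, ℝ)} (hp : p ∈ minorants c r₀ r₁)
    (hq : q ∈ minorants c r₀ r₁) : mix g p q ∈ minorants c r₀ r₁ := by
  intro x m
  have e : ∫ y, (mix g p q).1 (x, y) ∂(m : Measure Y) =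
      g x * ∫ y, p.1 (x, y) ∂(m : Measure Y) + (1 - g x) * ∫ y, q.1 (x, y) ∂(m : Measure Y) := by
    simp only [mix, ContinuousMap.coe_mk]
    rw [integral_add ((integrable_section _ _ _).const_mul _)
      ((integrable_section _ _ _).const_mul _), integral_const_mul, integral_const_mul]
  rw [e]
  have h1 := mul_le_mul_of_nonneg_left (hp x m) (hg x).1
  have h2 := mul_le_mul_of_nonneg_left (hq x m) (sub_nonneg.2 (hg x).2)
  simp only [mix, ContinuousMap.coe_mk]
  nlinarith

/-- `f` is the bounded almost everywhere limit of elements of `S`. -/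
def IsLimitOf (S : Set (C(X × Y, ℝ) × C(X, ℝ))) (μ : Measure X) (π : Measure (X × Y))
    (B : X × Y → ℝ) (A : X → ℝ) : Prop :=
  ∃ s : ℕ → C(X × Y, ℝ) × C(X, ℝ), (∀ n, s n ∈ S) ∧
    (∃ C : ℝ, ∀ n, (∀ z, |(s n).1 z| ≤ C) ∧ ∀ x, |(s n).2 x| ≤ C) ∧
    (∀ᵐ z ∂π, Tendsto (fun n => (s n).1 z) atTop (𝓝 (B z))) ∧
    ∀ᵐ x ∂μ, Tendsto (fun n => (s n).2 x) atTop (𝓝 (A x))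

theorem isLimitOf_self {S : Set (C(X × Y, ℝ) × C(X, ℝ))} (μ : Measure X) (π : Measure (X × Y))
    {p : C(X × Y, ℝ) × C(X, ℝ)} (hp : p ∈ S) : IsLimitOf S μ π p.1 p.2 := by
  refine ⟨fun _ => p, fun _ => hp, ⟨max ‖p.1‖ ‖p.2‖, fun n => ⟨fun z => ?_, fun x => ?_⟩⟩,
    ae_of_all _ fun _ => tendsto_const_nhds, ae_of_all _ fun _ => tendsto_const_nhds⟩
  · exact (p.1.norm_coe_le_norm z).trans (le_max_left _ _)
  · exact (p.2.norm_coe_le_norm x).trans (le_max_right _ _)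

theorem IsLimitOf.le {S : Set (C(X × Y, ℝ) × C(X, ℝ))} {μ : Measure X} {π : Measure (X × Y)}
    [IsFiniteMeasure μ] [IsFiniteMeasure π]
    {B : X × Y → ℝ} {A : X → ℝ} (h : IsLimitOf S μ π B A) {t : ℝ}
    (ht : ∀ p ∈ S, pairing μ π p ≤ t) : ∫ z, B z ∂π + ∫ x, A x ∂μ ≤ t := by
  obtain ⟨s, hs, ⟨C, hC⟩, hB, hA⟩ := h
  have h1 := tendsto_integral_of_dominated_convergence (μ := π) (fun _ => C)
    (fun n => (s n).1.continuous.measurable.aestronglyMeasurable) (integrable_const _)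
    (fun n => ae_of_all _ (hC n).1) hB
  have h2 := tendsto_integral_of_dominated_convergence (μ := μ) (fun _ => C)
    (fun n => (s n).2.continuous.measurable.aestronglyMeasurable) (integrable_const _)
    (fun n => ae_of_all _ (hC n).2) hA
  exact le_of_tendsto (h1.add h2) (Eventually.of_forall fun n => ht _ (hs n))

open Classical in
theorem IsLimitOf.ite {c : X → FiniteMeasure Y → ℝ} {r₀ r₁ : ℝ} {μ : Measure X}
    {π : Measure (X × Y)} [IsFiniteMeasure μ] [IsFiniteMeasure π]
    {B B' : X × Y → ℝ} {A A' : X → ℝ} (h : IsLimitOf (minorants c r₀ r₁) μ π B A)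
    (h' : IsLimitOf (minorants c r₀ r₁) μ π B' A') {E : Set X} (hE : MeasurableSet E) :
    IsLimitOf (minorants c r₀ r₁) μ π (fun z => if z.1 ∈ E then B z else B' z)
      (fun x => if x ∈ E then A x else A' x) := by
  obtain ⟨s, hs, ⟨C, hC⟩, hB, hA⟩ := h
  obtain ⟨s', hs', ⟨C', hC'⟩, hB', hA'⟩ := h'
  obtain ⟨g, hg, hlim⟩ := exists_seq_continuous_tendsto_indicator (μ + π.fst) hE
  rw [ae_add_measure_iff] at hlim
  have hlimπ : ∀ᵐ z ∂π, Tendsto (fun n => g n z.1) atTop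
      (𝓝 (E.indicator (fun _ => (1 : ℝ)) z.1)) :=
    ae_of_ae_map measurable_fst.aemeasurable hlim.2
  have key : ∀ {u v w : ℕ → ℝ} {a b e : ℝ}, Tendsto w atTop (𝓝 e) → Tendsto u atTop (𝓝 a) →
      Tendsto v atTop (𝓝 b) → Tendsto (fun n => w n * u n + (1 - w n) * v n) atTop
        (𝓝 (e * a + (1 - e) * b)) := fun hw hu hv =>
    (hw.mul hu).add ((tendsto_const_nhds.sub hw).mul hv)
  have hbd : ∀ {w u v : ℝ}, 0 ≤ w ∧ w ≤ 1 → |u| ≤ C → |v| ≤ C' →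
      |w * u + (1 - w) * v| ≤ max C C' := by
    intro w u v hw hu hv
    have hu' := abs_le.1 (hu.trans (le_max_left C C'))
    have hv' := abs_le.1 (hv.trans (le_max_right C C'))
    rw [abs_le]
    constructor <;> nlinarith
  refine ⟨fun n => mix (g n) (s n) (s' n), fun n => mix_mem_minorants (hg n) (hs n) (hs' n),
    ⟨max C C', fun n => ⟨fun z => hbd (hg n _) ((hC n).1 z) ((hC' n).1 z),
      fun x => hbd (hg n _) ((hC n).2 x) ((hC' n).2 x)⟩⟩, ?_, ?_⟩
  · filter_upwards [hlimπ, hB, hB'] with z h1 h2 h3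
    have := key h1 h2 h3
    by_cases hz : z.1 ∈ E <;> simpa [hz, mix] using this
  · filter_upwards [hlim.1, hA, hA'] with x h1 h2 h3
    have := key h1 h2 h3
    by_cases hz : x ∈ E <;> simpa [hz, mix] using this

theorem isLimitOf_selection {c : X → FiniteMeasure Y → ℝ} {r₀ r₁ : ℝ} {μ : Measure X}
    {π : Measure (X × Y)} [IsFiniteMeasure μ] [IsFiniteMeasure π]
    {p : ℕ → C(X × Y, ℝ) × C(X, ℝ)} (hp : ∀ k, p k ∈ minorants c r₀ r₁) (K : ℕ) :
    ∀ j : X → ℕ, Measurable j → (∀ x, j x ≤ K) →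
      IsLimitOf (minorants c r₀ r₁) μ π (fun z => (p (j z.1)).1 z) (fun x => (p (j x)).2 x) := by
  classical
  induction K with
  | zero =>
    intro j _ hjK
    have : j = fun _ => 0 := funext fun x => Nat.le_zero.1 (hjK x)
    subst this
    exact isLimitOf_self μ π (hp 0)
  | succ K ih =>
    intro j hj hjK
    have h1 := ih (fun x => min (j x) K) (hj.min measurable_const) fun x => min_le_right _ _
    have h2 := (isLimitOf_self μ π (hp (K + 1))).ite h1
      (hj (measurableSet_singleton (K + 1)))
    have key : ∀ x, j x ≠ K + 1 → min (j x) K = j x := fun x hx => by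
      have := hjK x
      omega
    convert h2 using 2 with z x
    · by_cases h : j z.1 = K + 1
      · simp [h]
      · simp [h, key]
    · by_cases h : j x = K + 1
      · simp [h]
      · simp [h, key]

theorem exists_measurable_argmax {α : Type*} [MeasurableSpace α] {G : ℕ → α → ℝ}
    (hG : ∀ k, Measurable (G k)) (K : ℕ) :
    ∃ j : α → ℕ, Measurable j ∧ (∀ x, j x ≤ K) ∧ ∀ x, ∀ k ≤ K, G k x ≤ G (j x) x := by
  classical
  have hsel : ∀ j : α → ℕ, Measurable j → Measurable fun x => G (j x) x := fun j hj =>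
    (measurable_from_prod_countable_right hG : Measurable fun z : ℕ × α => G z.1 z.2).comp
      (hj.prodMk measurable_id)
  induction K with
  | zero => exact ⟨fun _ => 0, measurable_const, fun _ => le_rfl, fun x k hk => by
      rw [Nat.le_zero.1 hk]⟩
  | succ K ih =>
    obtain ⟨j, hj, hjK, hmax⟩ := ih
    refine ⟨fun x => if G (j x) x ≤ G (K + 1) x then K + 1 else j x,
      Measurable.ite (measurableSet_le (hsel j hj) (hG _)) measurable_const hj, fun x => ?_,
      fun x k hk => ?_⟩
    · dsimp only
      split_ifs
      · exact le_rfl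
      · exact (hjK x).trans (Nat.le_succ K)
    · dsimp only
      rcases Nat.lt_or_ge K k with h | h
      · obtain rfl : k = K + 1 := by omega
        split_ifs with h'
        · exact le_rfl
        · exact (not_le.1 h').le
      · split_ifs with h'
        · exact (hmax x k h).trans h'
        · exact hmax x k h

end Selection

section Lagrangian

variable [CompactSpace X] [CompactSpace Y]

/-- The supremum of the linear parts of the affine minorants, i.e. the recession function of the
shifted cost. -/
def linSup (b : ℕ → C(X × Y, ℝ)) (x : X) (m : Measure Y) : ℝ≥0∞ :=
  ⨆ k, ENNReal.ofReal (∫ y, b k (x, y) ∂m)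

theorem integral_fiber (μ : Measure X) (π : ProbabilityMeasure (X × Y)) (x : X) (f : Y → ℝ) :
    ∫ y, f y ∂(fiber μ π x : Measure Y) =
      ((π : Measure (X × Y)).fst.rnDeriv μ x).toReal *
        ∫ y, f y ∂(π : Measure (X × Y)).condKernel x := by
  rw [fiber, FiniteMeasure.toMeasure_smul, integral_smul_nnreal_measure]
  rfl

theorem abs_integral_condKernel_le (π : Measure (X × Y)) [IsFiniteMeasure π] (B : C(X × Y, ℝ))
    (x z : X) : |∫ y, B (x, y) ∂π.condKernel z| ≤ ‖B‖ := by
  have := norm_integral_le_of_norm_le_const (μ := π.condKernel z)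
    (ae_of_all _ fun y => B.norm_coe_le_norm (x, y))
  simpa using this

theorem measurable_integral_condKernel (π : Measure (X × Y)) [IsFiniteMeasure π]
    (B : C(X × Y, ℝ)) : Measurable fun x => ∫ y, B (x, y) ∂π.condKernel x :=
  (StronglyMeasurable.integral_kernel_prod_right (κ := π.condKernel)
    (f := fun x y => B (x, y)) (by exact B.continuous.measurable.stronglyMeasurable)).measurable

theorem integral_fst_eq (μ : Measure X) [IsFiniteMeasure μ] (ρ : Measure X) [IsFiniteMeasure ρ]
    {h : X → ℝ} (hh : Measurable h) {C : ℝ} (hC : ∀ x, |h x| ≤ C) :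
    ∫ x, h x ∂ρ = ∫ x, (ρ.rnDeriv μ x).toReal * h x ∂μ + ∫ x, h x ∂(ρ.singularPart μ) := by
  have hi : ∀ (m : Measure X) [IsFiniteMeasure m], Integrable h m := fun m _ =>
    Integrable.of_bound hh.aestronglyMeasurable C (ae_of_all _ hC)
  conv_lhs => rw [ρ.haveLebesgueDecomposition_add μ]
  rw [integral_add_measure (hi _) (hi _), integral_withDensity_eq_integral_toReal_smul
    (Measure.measurable_rnDeriv _ _) (Measure.rnDeriv_lt_top _ _), add_comm]
  rfl

theorem IsRep.lintegral_add_le {c : X → FiniteMeasure Y → ℝ} {r₀ r₁ a b}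
    (hr : IsRep c r₀ r₁ a b) {μ : Measure X} [IsFiniteMeasure μ] {π : ProbabilityMeasure (X × Y)}
    {t : ℝ} (ht : ∀ p ∈ minorants c r₀ r₁, pairing μ (π : Measure (X × Y)) p ≤ t) :
    ∫⁻ x, excess c r₀ r₁ x (fiber μ π x) ∂μ +
      ∫⁻ z, linSup b z (condFM π z) ∂((π : Measure (X × Y)).fst.singularPart μ) ≤
      ENNReal.ofReal t := by
  classical
  set ρ := (π : Measure (X × Y)).fst with hρ
  set σ := ρ.singularPart μ with hσ
  let p : ℕ → C(X × Y, ℝ) × C(X, ℝ) := fun k => k.rec 0 fun k _ => (b k, a k)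
  have hp : ∀ k, p k ∈ minorants c r₀ r₁ := by
    rintro (_ | k) x m
    · simpa [p] using sub_nonneg.2 (hr.nonneg x m)
    · exact (hr.isLUB x m).1 ⟨k, rfl⟩
  let β : ℕ → X → ℝ := fun k x => ∫ y, (p k).1 (x, y) ∂(π : Measure (X × Y)).condKernel x
  have hβ : ∀ k, Measurable (β k) := fun k => measurable_integral_condKernel _ _
  let d : X → ℝ := fun x => (ρ.rnDeriv μ x).toReal
  have hd : Measurable d := (Measure.measurable_rnDeriv _ _).ennreal_toReal
  obtain ⟨Z, hZ, hσZ, hμZ⟩ := ρ.mutuallySingular_singularPart μ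
  have hμae : ∀ᵐ x ∂μ, x ∈ Z := hμZ
  have hσae : ∀ᵐ x ∂σ, x ∉ Z := by
    rw [ae_iff]
    simpa using hσZ
  let G : ℕ → X → ℝ := fun k x => if x ∈ Z then d x * β k x + (p k).2 x else β k x
  have hG : ∀ k, Measurable (G k) := fun k =>
    Measurable.ite hZ ((hd.mul (hβ k)).add (p k).2.continuous.measurable) (hβ k)
  choose j hj hjK hmax using fun K => exists_measurable_argmax hG K
  have hsel : ∀ (K : ℕ) (H : ℕ → X → ℝ), (∀ k, Measurable (H k)) →
      Measurable fun x => H (j K x) x := fun K H hH =>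
    (measurable_from_prod_countable_right hH : Measurable fun z : ℕ × X => H z.1 z.2).comp
      ((hj K).prodMk measurable_id)
  have hGsel := fun K => hsel K G hG
  have hG0 : ∀ K x, 0 ≤ G (j K x) x := fun K x => by
    refine le_trans (le_of_eq ?_) (hmax K x 0 (Nat.zero_le K))
    simp [G, β, p]
  have hbound : ∀ K, ∫⁻ x, ENNReal.ofReal (G (j K x) x) ∂(μ + σ) ≤ ENNReal.ofReal t := by
    intro K
    obtain ⟨C, hC⟩ : ∃ C, ∀ k ≤ K, ‖(p k).1‖ ≤ C ∧ ‖(p k).2‖ ≤ C := by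
      refine ⟨∑ k ∈ Finset.range (K + 1), (‖(p k).1‖ + ‖(p k).2‖), fun k hk => ?_⟩
      have := Finset.single_le_sum (f := fun k => ‖(p k).1‖ + ‖(p k).2‖)
        (fun i _ => by positivity) (Finset.mem_range.2 (Nat.lt_succ_of_le hk))
      have h1 := norm_nonneg (p k).1
      have h2 := norm_nonneg (p k).2
      constructor <;> linarith
    have hβC : ∀ x, |β (j K x) x| ≤ C := fun x =>
      (abs_integral_condKernel_le _ _ _ _).trans (hC _ (hjK K x)).1
    have hβm := hsel K β hβ
    have hAm : Measurable fun x => (p (j K x)).2 x :=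
      hsel K (fun k x => (p k).2 x) fun k => (p k).2.continuous.measurable
    have hAC : ∀ x, |(p (j K x)).2 x| ≤ C := fun x =>
      ((p (j K x)).2.norm_coe_le_norm x).trans (hC _ (hjK K x)).2
    have hBm : Measurable fun z : X × Y => (p (j K z.1)).1 z :=
      (measurable_from_prod_countable_right (fun k => (p k).1.continuous.measurable) :
        Measurable fun z : ℕ × (X × Y) => (p z.1).1 z.2).comp
        (((hj K).comp measurable_fst).prodMk measurable_id)
    have hBi : Integrable (fun z : X × Y => (p (j K z.1)).1 z) (π : Measure (X × Y)) :=
      Integrable.of_bound hBm.aestronglyMeasurable C (ae_of_all _ fun z =>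
        ((p (j K z.1)).1.norm_coe_le_norm z).trans (hC _ (hjK K z.1)).1)
    have hle := (isLimitOf_selection (μ := μ) (π := (π : Measure (X × Y))) hp K (j K) (hj K)
      (hjK K)).le ht
    rw [← Measure.integral_condKernel hBi, ← hρ] at hle
    rw [integral_fst_eq μ ρ (h := fun x => β (j K x) x) hβm hβC] at hle
    have hdi : Integrable (fun x => d x * β (j K x) x) μ :=
      Measure.integrable_toReal_rnDeriv.mul_bdd hβm.aestronglyMeasurable (ae_of_all _ hβC)
    have hAi : Integrable (fun x => (p (j K x)).2 x) μ :=
      Integrable.of_bound hAm.aestronglyMeasurable C (ae_of_all _ hAC)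
    have hβi : Integrable (fun x => β (j K x) x) σ :=
      Integrable.of_bound hβm.aestronglyMeasurable C (ae_of_all _ hβC)
    have e1 : (fun x => G (j K x) x) =ᵐ[μ] fun x => d x * β (j K x) x + (p (j K x)).2 x :=
      hμae.mono fun x hx => if_pos hx
    have e2 : (fun x => G (j K x) x) =ᵐ[σ] fun x => β (j K x) x :=
      hσae.mono fun x hx => if_neg hx
    have hi1 : Integrable (fun x => G (j K x) x) μ := (hdi.add hAi).congr e1.symm
    have hi2 : Integrable (fun x => G (j K x) x) σ := hβi.congr e2.symm
    rw [← ofReal_integral_eq_lintegral_ofReal (hi1.add_measure hi2) (ae_of_all _ (hG0 K)),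
      integral_add_measure hi1 hi2, integral_congr_ae e1, integral_congr_ae e2,
      integral_add hdi hAi]
    refine ENNReal.ofReal_le_ofReal ?_
    linarith
  have hmono : Monotone fun K x => ENNReal.ofReal (G (j K x) x) :=
    monotone_nat_of_le_succ fun K x => ENNReal.ofReal_le_ofReal
      (hmax (K + 1) x _ ((hjK K x).trans (Nat.le_succ K)))
  have hsup : ∫⁻ x, ⨆ K, ENNReal.ofReal (G (j K x) x) ∂(μ + σ) ≤ ENNReal.ofReal t := by
    rw [lintegral_iSup (fun K => (hGsel K).ennreal_ofReal) hmono]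
    exact iSup_le hbound
  have hGle : ∀ k x, ENNReal.ofReal (G k x) ≤ ⨆ K, ENNReal.ofReal (G (j K x) x) := fun k x =>
    (ENNReal.ofReal_le_ofReal (hmax k x k le_rfl)).trans
      (le_iSup (fun K => ENNReal.ofReal (G (j K x) x)) k)
  rw [lintegral_add_measure] at hsup
  refine le_trans (add_le_add (lintegral_mono_ae ?_) (lintegral_mono_ae ?_)) hsup
  · filter_upwards [hμae] with x hx
    by_cases htop : ⨆ K, ENNReal.ofReal (G (j K x) x) = ⊤
    · rw [htop]
      exact le_top
    refine ENNReal.ofReal_le_of_le_toReal ((hr.isLUB x (fiber μ π x)).2 ?_)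
    rintro _ ⟨k, rfl⟩
    have h1 := (ENNReal.ofReal_le_iff_le_toReal htop).1 (hGle (k + 1) x)
    refine le_trans (le_of_eq ?_) h1
    simp only [G, if_pos hx, integral_fiber]
    rfl
  · filter_upwards [hσae] with x hx
    refine iSup_le fun k => ?_
    refine le_trans (le_of_eq ?_) (hGle (k + 1) x)
    simp only [G, if_neg hx]
    rfl

end Lagrangian

section Kernels

variable [CompactSpace X] [CompactSpace Y]

theorem fiber_apply (μ : Measure X) (π : ProbabilityMeasure (X × Y)) (x : X) (s : Set Y) :
    (fiber μ π x : Measure Y) s =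
      ((π : Measure (X × Y)).fst.rnDeriv μ x).toNNReal *
        (π : Measure (X × Y)).condKernel x s := by
  rw [fiber, FiniteMeasure.toMeasure_smul]
  rfl

theorem isKernel_fiber (μ : Measure X) (π : ProbabilityMeasure (X × Y)) :
    IsKernel (fiber μ π) := by
  refine Measure.measurable_of_measurable_coe _ fun s hs => ?_
  simp only [fiber_apply]
  exact (Measure.measurable_rnDeriv _ _).ennreal_toNNReal.coe_nnreal_ennreal.mul
    (Kernel.measurable_coe _ hs)

theorem lintegral_fiber (μ : Measure X) [IsFiniteMeasure μ] (π : ProbabilityMeasure (X × Y))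
    {s : Set Y} (hs : MeasurableSet s) :
    ∫⁻ x, (fiber μ π x : Measure Y) s ∂μ +
      ∫⁻ z, (π : Measure (X × Y)).condKernel z s ∂((π : Measure (X × Y)).fst.singularPart μ) =
      (π : Measure (X × Y)).snd s := by
  set ρ := (π : Measure (X × Y)).fst
  have h1 : ∫⁻ x, (π : Measure (X × Y)).condKernel x s ∂ρ = (π : Measure (X × Y)).snd s := by
    rw [Measure.snd_apply hs, ← Measure.lintegral_condKernel_mem (measurable_snd hs)]
    rfl
  rw [← h1]
  conv_rhs => rw [ρ.haveLebesgueDecomposition_add μ]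
  rw [lintegral_add_measure, lintegral_withDensity_eq_lintegral_mul _
    (Measure.measurable_rnDeriv _ _) (Kernel.measurable_coe _ hs), add_comm]
  congr 1
  refine lintegral_congr_ae ?_
  filter_upwards [Measure.rnDeriv_lt_top ρ μ] with x hx
  rw [fiber_apply, ENNReal.coe_toNNReal hx.ne]
  rfl

theorem transports_fiber {μ : Measure X} [IsFiniteMeasure μ] {π : ProbabilityMeasure (X × Y)}
    (h : (π : Measure (X × Y)).fst ≪ μ) :
    Transports μ (fiber μ π) (π : Measure (X × Y)).snd := by
  ext s hs
  rw [Measure.bind_apply hs (isKernel_fiber μ π).aemeasurable, ← lintegral_fiber μ π hs,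
    Measure.singularPart_eq_zero_of_ac h]
  simp

theorem integrable_mass_fiber (μ : Measure X) [IsFiniteMeasure μ]
    (π : ProbabilityMeasure (X × Y)) :
    Integrable (fun x => ((fiber μ π x).mass : ℝ)) μ ∧
      ∫ x, ((fiber μ π x).mass : ℝ) ∂μ +
        ((π : Measure (X × Y)).fst.singularPart μ).real univ = 1 := by
  have h := lintegral_fiber μ π MeasurableSet.univ
  simp only [measure_univ, lintegral_one] at h
  have hm : Measurable fun x => (fiber μ π x : Measure Y) univ :=
    (Measure.measurable_coe MeasurableSet.univ).comp (isKernel_fiber μ π)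
  have hfin : ∫⁻ x, (fiber μ π x : Measure Y) univ ∂μ ≠ ⊤ := fun hh => by simp [hh] at h
  have e : ∀ x, ((fiber μ π x).mass : ℝ) = ((fiber μ π x : Measure Y) univ).toReal := fun x => rfl
  simp only [e]
  refine ⟨integrable_toReal_of_lintegral_ne_top hm.aemeasurable hfin, ?_⟩
  rw [integral_toReal hm.aemeasurable (ae_of_all _ fun x => measure_lt_top _ _), Measure.real,
    ← ENNReal.toReal_add hfin (measure_ne_top _ _), h, ENNReal.toReal_one]

theorem ofReal_integral_le_lintegral_ofReal {α : Type*} [MeasurableSpace α] (μ : Measure α)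
    (g : α → ℝ) : ENNReal.ofReal (∫ x, g x ∂μ) ≤ ∫⁻ x, ENNReal.ofReal (g x) ∂μ := by
  by_cases hg : Integrable g μ
  · rw [integral_eq_lintegral_pos_part_sub_lintegral_neg_part hg]
    refine le_trans (ENNReal.ofReal_le_ofReal (sub_le_self _ ENNReal.toReal_nonneg)) ?_
    exact ENNReal.ofReal_toReal_le
  · rw [integral_undef hg]
    simp

theorem IsRep.excess_add_le {c : X → FiniteMeasure Y → ℝ} {r₀ r₁ a b}
    (hr : IsRep c r₀ r₁ a b) (x : X) (m m' : FiniteMeasure Y) :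
    excess c r₀ r₁ x (m + m') ≤ excess c r₀ r₁ x m + linSup b x m' := by
  by_cases htop : linSup b x m' = ⊤
  · simp [htop]
  refine ENNReal.ofReal_le_of_le_toReal ((hr.isLUB x (m + m')).2 ?_)
  rintro _ ⟨k, rfl⟩
  rw [ENNReal.toReal_add (by simp [excess]) htop, excess,
    ENNReal.toReal_ofReal (sub_nonneg.2 (hr.nonneg x m))]
  have h1 : (∫ y, b k (x, y) ∂(m' : Measure Y)) ≤ (linSup b x m').toReal :=
    (ENNReal.ofReal_le_iff_le_toReal htop).1
      (le_iSup (fun k => ENNReal.ofReal (∫ y, b k (x, y) ∂(m' : Measure Y))) k)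
  have h2 := (hr.isLUB x m).1 ⟨k, rfl⟩
  dsimp only
  rw [FiniteMeasure.toMeasure_add, integral_add_measure (integrable_section _ _ _)
    (integrable_section _ _ _)]
  dsimp only at h2
  linarith

theorem linSup_bind_le (b : ℕ → C(X × Y, ℝ)) (x : X) (κ : Kernel X Y) [IsMarkovKernel κ]
    (σ : Measure X) [IsFiniteMeasure σ] :
    linSup b x (σ.bind κ) ≤ ∫⁻ z, linSup b x (κ z) ∂σ := by
  refine iSup_le fun k => ?_
  have hi : Integrable (fun y => b k (x, y)) (σ.bind κ) := integrable_section _ _ _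
  have e := Kernel.integral_comp (η := κ) (κ := Kernel.const Unit σ) (a := ())
    (f := fun y => b k (x, y)) (by rwa [Kernel.comp_apply, Kernel.const_apply])
  rw [Kernel.comp_apply, Kernel.const_apply] at e
  rw [e]
  exact (ofReal_integral_le_lintegral_ofReal _ _).trans (lintegral_mono fun z =>
    le_iSup (fun k => ENNReal.ofReal (∫ y, b k (x, y) ∂(κ z))) k)

end Kernels

section Smearing

variable [CompactSpace X] [CompactSpace Y]

theorem measurable_linSup (b : ℕ → C(X × Y, ℝ)) (κ : Kernel X Y) [IsSFiniteKernel κ] :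
    Measurable fun p : X × X => linSup b p.1 (κ p.2) := by
  refine Measurable.iSup fun k => Measurable.ennreal_ofReal ?_
  have : StronglyMeasurable fun p : (X × X) × Y => b k (p.1.1, p.2) :=
    ((b k).continuous.measurable.comp (by fun_prop)).stronglyMeasurable
  exact (this.integral_kernel_prod_right' (κ := κ.comap Prod.snd measurable_snd)).measurable

theorem IsRep.exists_transports {c : X → FiniteMeasure Y → ℝ} {r₀ r₁ a b}
    (hr : IsRep c r₀ r₁ a b) {μ : Measure X} [IsFiniteMeasure μ] {π : ProbabilityMeasure (X × Y)}
    {w : X → X → ℝ≥0∞} (hw : Measurable (Function.uncurry w))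
    (hw1 : ∀ᵐ z ∂((π : Measure (X × Y)).fst.singularPart μ), ∫⁻ x, w z x ∂μ = 1) :
    ∃ q : X → FiniteMeasure Y, IsKernel q ∧ Transports μ q (π : Measure (X × Y)).snd ∧
      ∫⁻ x, excess c r₀ r₁ x (q x) ∂μ ≤ ∫⁻ x, excess c r₀ r₁ x (fiber μ π x) ∂μ +
        ∫⁻ z, ∫⁻ x, w z x * linSup b x (condFM π z) ∂μ
          ∂((π : Measure (X × Y)).fst.singularPart μ) := by
  classical
  set σ := (π : Measure (X × Y)).fst.singularPart μ
  set κ := (π : Measure (X × Y)).condKernel with hκ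
  have hwz : ∀ x, Measurable fun z => w z x := fun x => hw.comp (by fun_prop : Measurable
    fun z => (z, x))
  let M : X → Measure Y := fun x => (σ.withDensity fun z => w z x).bind κ
  have hMs : ∀ x {s}, MeasurableSet s → M x s = ∫⁻ z, w z x * κ z s ∂σ := by
    intro x s hs
    rw [Measure.bind_apply hs κ.measurable.aemeasurable,
      lintegral_withDensity_eq_lintegral_mul _ (hwz x) (Kernel.measurable_coe _ hs)]
    rfl
  have hjm : ∀ {s}, MeasurableSet s → Measurable (Function.uncurry fun z x => w z x * κ z s) :=
    fun hs => hw.mul ((Kernel.measurable_coe _ hs).comp measurable_fst)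
  have hM : Measurable M := by
    refine Measure.measurable_of_measurable_coe _ fun s hs => ?_
    simp only [hMs _ hs]
    exact (hjm hs).lintegral_prod_left
  have hMint : ∀ {s}, MeasurableSet s → ∫⁻ x, M x s ∂μ = ∫⁻ z, κ z s ∂σ := by
    intro s hs
    simp only [hMs _ hs]
    rw [← lintegral_lintegral_swap (hjm hs).aemeasurable]
    refine lintegral_congr_ae ?_
    filter_upwards [hw1] with z hz
    have hwx : Measurable fun x => w z x := hw.comp measurable_prodMk_left
    rw [lintegral_mul_const _ hwx, hz, one_mul]
  have hMu : Measurable fun x => M x univ := (Measure.measurable_coe MeasurableSet.univ).comp hM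
  have hfin : ∀ᵐ x ∂μ, M x univ < ⊤ := by
    refine ae_lt_top hMu ?_
    rw [hMint MeasurableSet.univ]
    simp
  let N : X → FiniteMeasure Y := fun x => if h : M x univ < ⊤ then ⟨M x, ⟨h⟩⟩ else 0
  have hN : ∀ x, M x univ < ⊤ → (N x : Measure Y) = M x := fun x hx => by
    have : N x = ⟨M x, ⟨hx⟩⟩ := dif_pos hx
    rw [this]
    rfl
  have hNk : IsKernel N := by
    have : (fun x => (N x : Measure Y)) = fun x => if M x univ < ⊤ then M x else 0 := by
      ext1 x
      by_cases hx : M x univ < ⊤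
      · rw [hN x hx, if_pos hx]
      · have : N x = 0 := dif_neg hx
        rw [if_neg hx, this]
        rfl
    rw [IsKernel, this]
    exact Measurable.ite (measurableSet_lt hMu measurable_const) hM measurable_const
  have hq : IsKernel fun x => fiber μ π x + N x := by
    refine Measure.measurable_of_measurable_coe _ fun s hs => ?_
    simp only [FiniteMeasure.toMeasure_add, Measure.add_apply]
    exact ((Measure.measurable_coe hs).comp (isKernel_fiber μ π)).add
      ((Measure.measurable_coe hs).comp hNk)
  refine ⟨fun x => fiber μ π x + N x, hq, ?_, ?_⟩
  · ext s hs
    have hf : Measurable fun x => (fiber μ π x : Measure Y) s :=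
      (Measure.measurable_coe hs).comp (isKernel_fiber μ π)
    rw [Measure.bind_apply hs hq.aemeasurable, ← lintegral_fiber μ π hs, ← hMint hs,
      ← lintegral_add_left hf]
    refine lintegral_congr_ae ?_
    filter_upwards [hfin] with x hx
    rw [FiniteMeasure.toMeasure_add, Measure.add_apply, hN x hx]
  · have hjl : Measurable (Function.uncurry fun z x => w z x * linSup b x (κ z)) :=
      hw.mul ((measurable_linSup b κ).comp measurable_swap)
    have e : ∀ z x, linSup b x (condFM π z : Measure Y) = linSup b x (κ z) := fun _ _ => rfl
    simp only [e]
    rw [lintegral_lintegral_swap hjl.aemeasurable,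
      ← lintegral_add_left (hr.measurable_excess (isKernel_fiber μ π))]
    refine lintegral_mono_ae ?_
    filter_upwards [hfin] with x hx
    refine (hr.excess_add_le x _ _).trans ?_
    gcongr
    rw [hN x hx]
    have : IsFiniteMeasure (σ.withDensity fun z => w z x) := by
      refine ⟨?_⟩
      rw [hMs x MeasurableSet.univ] at hx
      simpa [withDensity_apply] using hx
    refine (linSup_bind_le b x κ _).trans ?_
    have hl : Measurable fun z => linSup b x (κ z) :=
      (measurable_linSup b κ).comp measurable_prodMk_left
    rw [lintegral_withDensity_eq_lintegral_mul _ (hwz x) hl]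
    rfl

theorem IsRep.transportCost_le {c : X → FiniteMeasure Y → ℝ} {r₀ r₁ a b}
    (hr : IsRep c r₀ r₁ a b) {μ : Measure X} {ν : Measure Y} [IsProbabilityMeasure μ]
    [IsProbabilityMeasure ν] {q : X → FiniteMeasure Y} (hq : IsKernel q)
    (hT : Transports μ q ν) :
    transportCost c μ ν ≤
      ((∫⁻ x, excess c r₀ r₁ x (q x) ∂μ : ℝ≥0∞) : EReal) + ((r₀ + r₁ : ℝ) : EReal) := by
  refine sInf_le ⟨q, hq, hT, ?_⟩
  have hm := hT.integrable_mass hq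
  rw [hr.eintegralR_eq hq hm.1, hm.2]
  simp

end Smearing

section Recession

theorem tendsto_add_div_nnreal (v C : ℝ) :
    Tendsto (fun lam : ℝ≥0 => ((v + C / (lam : ℝ) : ℝ) : EReal)) atTop (𝓝 (v : EReal)) := by
  refine (continuous_coe_real_ereal.tendsto v).comp ?_
  have : Tendsto (fun lam : ℝ≥0 => C / (lam : ℝ)) atTop (𝓝 0) :=
    tendsto_const_nhds.div_atTop (NNReal.tendsto_coe_atTop.2 tendsto_id)
  simpa using tendsto_const_nhds.add this

theorem le_recession {c : X → FiniteMeasure Y → ℝ} {x : X} {m : FiniteMeasure Y} {v C : ℝ}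
    (h : ∀ lam : ℝ≥0, (lam : ℝ) * v + C ≤ c x (lam • m)) : (v : EReal) ≤ recession c x m := by
  rw [← (tendsto_add_div_nnreal v C).limsup_eq]
  refine limsup_le_limsup ?_
  filter_upwards [eventually_gt_atTop 0] with lam hlam
  have hl : (0 : ℝ) < lam := hlam
  rw [EReal.coe_le_coe_iff, le_div_iff₀ hl]
  refine le_trans (le_of_eq ?_) (h lam)
  field_simp

theorem recession_le {c : X → FiniteMeasure Y → ℝ} {x : X} {m : FiniteMeasure Y} {v C : ℝ}
    (h : ∀ lam : ℝ≥0, c x (lam • m) ≤ (lam : ℝ) * v + C) : recession c x m ≤ (v : EReal) := by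
  rw [← (tendsto_add_div_nnreal v C).limsup_eq]
  refine limsup_le_limsup ?_
  filter_upwards [eventually_gt_atTop 0] with lam hlam
  have hl : (0 : ℝ) < lam := hlam
  rw [EReal.coe_le_coe_iff, div_le_iff₀ hl]
  refine (h lam).trans (le_of_eq ?_)
  field_simp

theorem integral_smul_finiteMeasure (f : Y → ℝ) (lam : ℝ≥0) (m : FiniteMeasure Y) :
    ∫ y, f y ∂((lam • m : FiniteMeasure Y) : Measure Y) = lam * ∫ y, f y ∂(m : Measure Y) := by
  rw [FiniteMeasure.toMeasure_smul, integral_smul_nnreal_measure]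
  rfl

theorem mass_smul_finiteMeasure (lam : ℝ≥0) (m : FiniteMeasure Y) :
    ((lam • m : FiniteMeasure Y).mass : ℝ) = lam * m.mass := by
  rw [FiniteMeasure.mass, FiniteMeasure.smul_apply, smul_eq_mul, NNReal.coe_mul]
  rfl

theorem IsRep.recession_eq {c : X → FiniteMeasure Y → ℝ} {r₀ r₁ a b}
    (hr : IsRep c r₀ r₁ a b) (x : X) (m : FiniteMeasure Y) :
    recession c x m = (linSup b x m : EReal) + ((r₁ * (m.mass : ℝ) : ℝ) : EReal) := by
  refine le_antisymm ?_ ?_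
  · by_cases htop : linSup b x m = ⊤
    · rw [htop, EReal.coe_ennreal_top, EReal.top_add_coe]
      exact le_top
    rw [← EReal.coe_ennreal_toReal htop, ← EReal.coe_add]
    refine recession_le (C := c x 0) fun lam => ?_
    have : c x (lam • m) - (r₀ + r₁ * ((lam • m : FiniteMeasure Y).mass : ℝ)) ≤
        lam * (linSup b x m).toReal + (c x 0 - r₀) := by
      refine (hr.isLUB x (lam • m)).2 ?_
      rintro _ ⟨k, rfl⟩
      dsimp only
      rw [integral_smul_finiteMeasure]
      have h1 : (∫ y, b k (x, y) ∂(m : Measure Y)) ≤ (linSup b x m).toReal :=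
        (ENNReal.ofReal_le_iff_le_toReal htop).1
          (le_iSup (fun k => ENNReal.ofReal (∫ y, b k (x, y) ∂(m : Measure Y))) k)
      have h2 := (hr.isLUB x 0).1 ⟨k, rfl⟩
      simp only [FiniteMeasure.toMeasure_zero, integral_zero_measure, FiniteMeasure.zero_mass,
        NNReal.coe_zero] at h2
      have h3 := mul_le_mul_of_nonneg_left h1 lam.coe_nonneg
      linarith
    rw [mass_smul_finiteMeasure] at this
    linarith
  · rw [← EReal.le_sub_iff_add_le (.inl (EReal.coe_ne_bot _)) (.inl (EReal.coe_ne_top _))]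
    have key : ∀ v C : ℝ, (∀ lam : ℝ≥0, (lam : ℝ) * v + C ≤
        c x (lam • m) - (r₀ + r₁ * ((lam • m : FiniteMeasure Y).mass : ℝ))) →
        (v : EReal) ≤ recession c x m - ((r₁ * (m.mass : ℝ) : ℝ) : EReal) := by
      intro v C h
      rw [EReal.le_sub_iff_add_le (.inl (EReal.coe_ne_bot _)) (.inl (EReal.coe_ne_top _)),
        ← EReal.coe_add]
      refine le_recession (C := C + r₀) fun lam => ?_
      have := h lam
      rw [mass_smul_finiteMeasure] at this
      linarith
    have h0 : (0 : EReal) ≤ recession c x m - ((r₁ * (m.mass : ℝ) : ℝ) : EReal) := by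
      refine key 0 0 fun lam => ?_
      simpa using hr.nonneg x (lam • m)
    rw [← EReal.coe_toENNReal h0, EReal.coe_ennreal_le_coe_ennreal_iff]
    refine iSup_le fun k => ?_
    rw [← EReal.real_coe_toENNReal]
    refine EReal.toENNReal_le_toENNReal (key _ (a k x) fun lam => ?_)
    rw [← integral_smul_finiteMeasure]
    exact (hr.isLUB x (lam • m)).1 ⟨k, rfl⟩

end Recession

section Cases

variable [CompactSpace X] [CompactSpace Y]

theorem measurable_linSup_diag (b : ℕ → C(X × Y, ℝ)) (π : ProbabilityMeasure (X × Y)) :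
    Measurable fun z => linSup b z (condFM π z) :=
  (measurable_linSup b (π : Measure (X × Y)).condKernel).comp
    (measurable_id.prodMk measurable_id)

theorem mass_condFM (π : ProbabilityMeasure (X × Y)) (z : X) : (condFM π z).mass = 1 := by
  rw [← ENNReal.coe_inj, FiniteMeasure.ennreal_mass]
  exact measure_univ (μ := (π : Measure (X × Y)).condKernel z)

theorem IsRep.barI_eq {c : X → FiniteMeasure Y → ℝ} {r₀ r₁ a b}
    (hr : IsRep c r₀ r₁ a b) {μ : Measure X} [IsProbabilityMeasure μ]
    (π : ProbabilityMeasure (X × Y)) :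
    barI c μ π = ((∫⁻ x, excess c r₀ r₁ x (fiber μ π x) ∂μ +
      ∫⁻ z, linSup b z (condFM π z) ∂((π : Measure (X × Y)).fst.singularPart μ) : ℝ≥0∞) : EReal) +
      ((r₀ + r₁ : ℝ) : EReal) := by
  have hm := integrable_mass_fiber μ π
  simp only [barI, hr.recession_eq, mass_condFM]
  rw [hr.eintegralR_eq (isKernel_fiber μ π) hm.1, eintegral_add_real
    (measurable_linSup_diag b π) (integrable_const _), EReal.coe_ennreal_add,
    add_add_add_comm, ← EReal.coe_add]
  congr 2
  simp only [probReal_univ, NNReal.coe_one, integral_const, smul_eq_mul]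
  linear_combination r₁ * hm.2

theorem IsRep.transportCost_le_of_approx {c : X → FiniteMeasure Y → ℝ} {r₀ r₁ a b}
    (hr : IsRep c r₀ r₁ a b) (h : AssumpApprox c) {μ : Measure X} {ν : Measure Y}
    [IsProbabilityMeasure μ] [IsProbabilityMeasure ν] {π : ProbabilityMeasure (X × Y)}
    (hπ : IsPlan (msupport μ) ν (π : Measure (X × Y))) :
    transportCost c μ ν ≤ ((∫⁻ x, excess c r₀ r₁ x (fiber μ π x) ∂μ +
      ∫⁻ z, linSup b z (condFM π z) ∂((π : Measure (X × Y)).fst.singularPart μ) : ℝ≥0∞) : EReal) +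
      ((r₀ + r₁ : ℝ) : EReal) := by
  rw [← hr.barI_eq π]
  have hS : (π : Measure (X × Y)).fst (msupport μ) = 1 := by
    rw [Measure.fst_apply (isClosed_msupport μ).measurableSet]
    exact (mem_ae_iff_prob_eq_one (measurable_fst (isClosed_msupport μ).measurableSet)).1 hπ.carried
  obtain ⟨s, hs, hlim⟩ := h μ ν ‹_› ‹_› π ⟨hS, hπ.snd_eq⟩
  refine ge_of_tendsto' hlim fun n => sInf_le ⟨fiber μ (s n), isKernel_fiber μ _, ?_, rfl⟩
  rw [← (hs n).2]
  exact transports_fiber (hs n).1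

theorem IsRep.transportCost_le_of_superlinear {c : X → FiniteMeasure Y → ℝ} {r₀ r₁ a b}
    (hr : IsRep c r₀ r₁ a b) (h : AssumpB c) {μ : Measure X} {ν : Measure Y}
    [IsProbabilityMeasure μ] [IsProbabilityMeasure ν] {π : ProbabilityMeasure (X × Y)}
    (hπ : IsPlan (msupport μ) ν (π : Measure (X × Y))) :
    transportCost c μ ν ≤ ((∫⁻ x, excess c r₀ r₁ x (fiber μ π x) ∂μ +
      ∫⁻ z, linSup b z (condFM π z) ∂((π : Measure (X × Y)).fst.singularPart μ) : ℝ≥0∞) : EReal) +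
      ((r₀ + r₁ : ℝ) : EReal) := by
  have htop : ∀ z, linSup b z (condFM π z) = ⊤ := by
    intro z
    have h0 : condFM π z ≠ 0 := fun h0 => by
      have := mass_condFM π z
      simp [h0] at this
    have h1 : recession c z (condFM π z) = ⊤ :=
      (EReal.tendsto_coe_nhds_top_iff.2 (h z _ h0)).limsup_eq
    rw [hr.recession_eq] at h1
    by_contra hne
    rw [← EReal.coe_ennreal_toReal hne, ← EReal.coe_add] at h1
    exact EReal.coe_ne_top _ h1
  by_cases hσ : (π : Measure (X × Y)).fst.singularPart μ = 0
  · have hT := transports_fiber ((Measure.singularPart_eq_zero _ _).1 hσ)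
    rw [hπ.snd_eq] at hT
    simpa [hσ] using hr.transportCost_le (isKernel_fiber μ π) hT
  · simp only [htop, lintegral_const]
    rw [ENNReal.top_mul (by simpa using hσ), add_top, EReal.coe_ennreal_top, EReal.top_add_coe]
    exact le_top

theorem IsRep.transportCost_le_of_continuous {c : X → FiniteMeasure Y → ℝ} {r₀ r₁ a b}
    (hr : IsRep c r₀ r₁ a b) (h : AssumpC c) {μ : Measure X} {ν : Measure Y}
    [IsProbabilityMeasure μ] [IsProbabilityMeasure ν] {π : ProbabilityMeasure (X × Y)}
    (hπ : IsPlan (msupport μ) ν (π : Measure (X × Y))) :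
    transportCost c μ ν ≤ ((∫⁻ x, excess c r₀ r₁ x (fiber μ π x) ∂μ +
      ∫⁻ z, linSup b z (condFM π z) ∂((π : Measure (X × Y)).fst.singularPart μ) : ℝ≥0∞) : EReal) +
      ((r₀ + r₁ : ℝ) : EReal) := by
  classical
  let := TopologicalSpace.upgradeIsCompletelyMetrizable X
  obtain ⟨-, hcont, A, -, hA⟩ := h
  set σ := (π : Measure (X × Y)).fst.singularPart μ with hσ
  let ε : ℕ → ℝ := fun n => 1 / ((n : ℝ) + 1)
  have hε : ∀ n, 0 < ε n := fun n => Nat.one_div_pos_of_nat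
  have hεlim : Tendsto ε atTop (𝓝 0) := tendsto_one_div_add_atTop_nhds_zero_nat
  let w : ℕ → X → X → ℝ≥0∞ := fun n z x =>
    if dist x z < ε n then (μ (ball z (ε n)))⁻¹ else 0
  have hset : ∀ n, MeasurableSet {p : X × X | dist p.2 p.1 < ε n} := fun n =>
    (isOpen_lt (by fun_prop) continuous_const).measurableSet
  have hw : ∀ n, Measurable (Function.uncurry (w n)) := by
    intro n
    have h1 : Measurable fun z => μ (ball z (ε n)) := measurable_measure_prodMk_left (hset n)
    exact Measurable.ite (hset n) (h1.comp measurable_fst).inv measurable_const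
  have hwind : ∀ n z, w n z = (ball z (ε n)).indicator fun _ => (μ (ball z (ε n)))⁻¹ :=
    fun n z => rfl
  have hz : ∀ᵐ z ∂σ, z ∈ msupport μ := by
    refine ae_mono (Measure.singularPart_le _ _) ?_
    exact (ae_map_iff measurable_fst.aemeasurable (isClosed_msupport μ).measurableSet).2
      hπ.carried
  have hw1 : ∀ n, ∀ z ∈ msupport μ, ∫⁻ x, w n z x ∂μ = 1 := by
    intro n z hz
    rw [hwind, lintegral_indicator_const measurableSet_ball]
    exact ENNReal.inv_mul_cancel (hz _ isOpen_ball (mem_ball_self (hε n))).ne'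
      (measure_ne_top _ _)
  have hle : ∀ x z, linSup b x (condFM π z) ≤ ENNReal.ofReal (A - r₁) := by
    intro x z
    have h1 := hA x (condFM π z) (mass_condFM π z)
    rw [hr.recession_eq, mass_condFM, ← EReal.le_sub_iff_add_le (.inl (EReal.coe_ne_bot _))
      (.inl (EReal.coe_ne_top _)), ← EReal.coe_sub] at h1
    rw [← EReal.coe_ennreal_le_coe_ennreal_iff, EReal.coe_ennreal_ofReal]
    refine h1.trans (EReal.coe_le_coe_iff.2 ?_)
    simp
  let H : ℕ → X → ℝ≥0∞ := fun n z => ∫⁻ x, w n z x * linSup b x (condFM π z) ∂μ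
  have hwx : ∀ n z, Measurable fun x => w n z x := fun n z => (hw n).comp measurable_prodMk_left
  have hH : ∀ n, Measurable (H n) := fun n => by
    have : Measurable (Function.uncurry fun z x => w n z x * linSup b x (condFM π z)) :=
      (hw n).mul ((measurable_linSup b (π : Measure (X × Y)).condKernel).comp measurable_swap)
    exact this.lintegral_prod_right
  have hbound : ∀ n, H n ≤ᵐ[σ] fun _ => ENNReal.ofReal (A - r₁) := by
    intro n
    filter_upwards [hz] with z hz
    calc H n z ≤ ∫⁻ x, w n z x * ENNReal.ofReal (A - r₁) ∂μ :=
          lintegral_mono fun x => mul_le_mul_right (hle x z) _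
      _ = ENNReal.ofReal (A - r₁) := by
          rw [lintegral_mul_const _ (hwx n z), hw1 n z hz, one_mul]
  have hlimsup : ∀ z ∈ msupport μ, limsup (fun n => H n z) atTop ≤ linSup b z (condFM π z) := by
    intro z hz
    refine le_of_forall_gt_imp_ge_of_dense fun δ hδ => ?_
    by_cases hδt : δ = ⊤
    · rw [hδt]
      exact le_top
    have hlt : recession c z (condFM π z) < ((δ.toReal + r₁ : ℝ) : EReal) := by
      rw [hr.recession_eq, mass_condFM, EReal.coe_add, NNReal.coe_one, mul_one]
      refine EReal.add_lt_add_right_coe ?_ _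
      rw [EReal.coe_ennreal_toReal hδt]
      exact EReal.coe_ennreal_lt_coe_ennreal_iff.2 hδ
    obtain ⟨η, hη, hball⟩ := Metric.eventually_nhds_iff.1
      (((hcont (condFM π z)).tendsto z).eventually_lt_const hlt)
    have hx : ∀ x, dist x z < η → linSup b x (condFM π z) ≤ δ := by
      intro x hx
      by_contra! hcon
      refine (hball hx).not_ge ?_
      rw [hr.recession_eq, mass_condFM, EReal.coe_add, NNReal.coe_one, mul_one,
        EReal.coe_ennreal_toReal hδt]
      gcongr
      exact EReal.coe_ennreal_le_coe_ennreal_iff.2 hcon.le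
    refine limsup_le_of_le (by isBoundedDefault) ?_
    filter_upwards [hεlim.eventually_lt_const hη] with n hn
    calc H n z ≤ ∫⁻ x, w n z x * δ ∂μ := by
          refine lintegral_mono fun x => ?_
          by_cases hd : dist x z < ε n
          · exact mul_le_mul_right (hx x (hd.trans hn)) _
          · simp [w, hd]
      _ = δ := by rw [lintegral_mul_const _ (hwx n z), hw1 n z hz, one_mul]
  have hcost : ∀ n, transportCost c μ ν - ((r₀ + r₁ : ℝ) : EReal) ≤
      ((∫⁻ x, excess c r₀ r₁ x (fiber μ π x) ∂μ + ∫⁻ z, H n z ∂σ : ℝ≥0∞) : EReal) := by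
    intro n
    obtain ⟨q, hq, hT, hqle⟩ := hr.exists_transports (hw n) (hz.mono (hw1 n))
    rw [hπ.snd_eq] at hT
    refine EReal.sub_le_of_le_add ((hr.transportCost_le hq hT).trans ?_)
    gcongr
    exact EReal.coe_ennreal_le_coe_ennreal_iff.2 hqle
  have hlim : limsup (fun n => ∫⁻ z, H n z ∂σ) atTop ≤ ∫⁻ z, linSup b z (condFM π z) ∂σ := by
    refine (limsup_lintegral_le _ hH hbound ?_).trans (lintegral_mono_ae (hz.mono hlimsup))
    simp [ENNReal.mul_eq_top]
  set T := (transportCost c μ ν - ((r₀ + r₁ : ℝ) : EReal)).toENNReal with hT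
  have hTle : ∀ n, T ≤ ∫⁻ x, excess c r₀ r₁ x (fiber μ π x) ∂μ + ∫⁻ z, H n z ∂σ := fun n =>
    (EReal.toENNReal_le_toENNReal (hcost n)).trans (le_of_eq EReal.toENNReal_coe)
  have hTfin : T ≤ ∫⁻ x, excess c r₀ r₁ x (fiber μ π x) ∂μ +
      ∫⁻ z, linSup b z (condFM π z) ∂σ := by
    rw [← tsub_le_iff_left]
    refine le_trans ?_ hlim
    refine le_limsup_of_frequently_le (Frequently.of_forall fun n => ?_) (by isBoundedDefault)
    exact tsub_le_iff_left.2 (hTle n)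
  rw [← EReal.sub_le_iff_le_add (.inl (EReal.coe_ne_bot _)) (.inl (EReal.coe_ne_top _))]
  exact ((le_max_right _ _).trans_eq EReal.coe_toENNReal_eq_max.symm).trans (EReal.coe_ennreal_le_coe_ennreal_iff.2 hTfin)

end Cases

section Duality

variable [CompactSpace X] [CompactSpace Y]

theorem IsRep.transportCost_le_coe {c : X → FiniteMeasure Y → ℝ} {r₀ r₁ a b}
    (hr : IsRep c r₀ r₁ a b) (h : AssumpApprox c ∨ AssumpB c ∨ AssumpC c)
    {μ : Measure X} {ν : Measure Y} [IsProbabilityMeasure μ] [IsProbabilityMeasure ν] {t : ℝ}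
    (ht : ⨆ f : C(Y, ℝ), (eintegral μ (fun x => Kc c f x) - ((∫ y, f y ∂ν : ℝ) : EReal)) <
      (t : EReal)) :
    transportCost c μ ν ≤ (t : EReal) := by
  have h0 : ((0, 0) : C(X × Y, ℝ) × C(X, ℝ)) ∈ minorants c r₀ r₁ := fun x m => by
    simpa using hr.nonneg x m
  obtain ⟨π, hπ, hle⟩ := exists_isPlan_pairing_le (isClosed_msupport μ) (msupport_nonempty μ)
    μ ν (convex_minorants c r₀ r₁) ⟨_, h0⟩ (t - r₀ - r₁)
    fun p hp => exists_isPlan_pairing_lt μ ν ht hp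
  have ht0 : 0 ≤ t - r₀ - r₁ := by simpa [pairing] using hle _ h0
  obtain ⟨π, rfl⟩ : ∃ π' : ProbabilityMeasure (X × Y), (π' : Measure (X × Y)) = π :=
    ⟨⟨π, hπ.prob⟩, rfl⟩
  have key := hr.lintegral_add_le hle
  have hcost : transportCost c μ ν ≤ ((∫⁻ x, excess c r₀ r₁ x (fiber μ π x) ∂μ +
      ∫⁻ z, linSup b z (condFM π z) ∂((π : Measure (X × Y)).fst.singularPart μ) : ℝ≥0∞) : EReal) +
      ((r₀ + r₁ : ℝ) : EReal) := by
    rcases h with h | h | h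
    · exact hr.transportCost_le_of_approx h hπ
    · exact hr.transportCost_le_of_superlinear h hπ
    · exact hr.transportCost_le_of_continuous h hπ
  refine (hcost.trans (add_le_add (EReal.coe_ennreal_le_coe_ennreal_iff.2 key) le_rfl)).trans
    (le_of_eq ?_)
  rw [EReal.coe_ennreal_ofReal, max_eq_left ht0, ← EReal.coe_add]
  congr 1
  ring

end Duality

/-- Theorem `thm:duality2`: under Assumption (A) and any of Assumptions
(Approx), (B) or (C), the Kantorovich-type duality formula
`I_c(μ,ν) = sup_{f ∈ C_b(Y)} { ∫ K_c f dμ − ∫ f dν }` holds, the integral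
`∫ K_c f dμ` being understood in `ℝ ∪ {−∞}`. -/
theorem transportCost_duality
    [CompactSpace X] [CompactSpace Y]
    (c : X → FiniteMeasure Y → ℝ) (hc : IsCost c) (hA : AssumpA c)
    (h : AssumpApprox c ∨ AssumpB c ∨ AssumpC c)
    (μ : Measure X) (ν : Measure Y)
    [IsProbabilityMeasure μ] [IsProbabilityMeasure ν] :
    transportCost c μ ν =
      ⨆ f : C(Y, ℝ),
        (eintegral μ (fun x => Kc c f x) - ((∫ y, f y ∂ν : ℝ) : EReal)) := by
  obtain ⟨r₀, r₁, a, b, hr⟩ := exists_isRep hc hA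
  refine le_antisymm ?_ (iSup_le fun f => hr.dual_le μ ν f)
  refine le_of_forall_gt_imp_ge_of_dense fun s hs => ?_
  obtain ⟨t, hst, hts⟩ := EReal.lt_iff_exists_real_btwn.1 hs
  exact (hr.transportCost_le_coe h hst).trans hts.le

end UWOT
end
end
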